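/- arXiv:0809.4579 — 7 statements merged into one kernel-verified Lean document; each statement's English description precedes it below -/
import Mathlib

section
/- Let K be an algebraically closed field, complete with respect to a nontrivial nonarchimedean multiplicative norm |·|, and let (a_n)_{n∈ℤ} be a family of elements of K. Suppose that for every t ∈ K with 0 < |t| < 1 the family (a_n·t^n)_{n∈ℤ} is summable, with sum f(t), and suppose there is a constant M such that |f(t)| ≤ M for all t with 0 < |t| < 1. Then a_n = 0 for all n < 0; in particular f extends to the function on the full open unit disk given by the everywhere-convergent power series ∑_{n≥0} a_n t^n. -/
theorem aux_sub_le {K : Type*} [NormedField K] [IsUltrametricDist K] (x y : K) :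
    ‖x - y‖ ≤ max ‖x‖ ‖y‖ := by
  have h := IsUltrametricDist.norm_add_le_max x (-y)
  rwa [norm_neg, ← sub_eq_add_neg] at h

theorem aux_exists_unit_nat {K : Type*} [NormedField K] [IsUltrametricDist K] (B : ℕ) :
    ∃ N : ℕ, B ≤ N ∧ ‖(N : K)‖ = 1 := by
  by_cases h : ‖(B : K)‖ = 1
  · exact ⟨B, le_rfl, h⟩
  · refine ⟨B + 1, by omega, ?_⟩
    have h1 : ‖(B : K)‖ < 1 :=
      lt_of_le_of_ne (IsUltrametricDist.norm_natCast_le_one K B) h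
    refine le_antisymm (IsUltrametricDist.norm_natCast_le_one K (B + 1)) ?_
    by_contra h2
    push Not at h2
    have h3 : ‖((B + 1 : ℕ) : K) - (B : K)‖ ≤ max ‖((B + 1 : ℕ) : K)‖ ‖(B : K)‖ :=
      aux_sub_le _ _
    have h4 : ((B + 1 : ℕ) : K) - (B : K) = 1 := by push_cast; ring
    rw [h4, norm_one] at h3
    exact absurd h3 (not_le.mpr (max_lt h2 h1))

/-- A weak form of the nonarchimedean Cauchy estimate, by averaging over roots of unity. -/
theorem aux_cauchy
    {K : Type*} [NormedField K] [IsUltrametricDist K] [IsAlgClosed K]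
    (a : ℤ → K)
    (hsum : ∀ t : K, 0 < ‖t‖ → ‖t‖ < 1 → Summable fun n : ℤ => a n * t ^ n)
    (M : ℝ)
    (hbd : ∀ t : K, 0 < ‖t‖ → ‖t‖ < 1 → ‖∑' n : ℤ, a n * t ^ n‖ ≤ M)
    (t : K) (ht0 : 0 < ‖t‖) (ht1 : ‖t‖ < 1) (m : ℤ) :
    ‖a m * t ^ m‖ ≤ max M 1 := by
  classical
  have hM : 0 ≤ M := (norm_nonneg _).trans (hbd t ht0 ht1)
  have htend := (hsum t ht0 ht1).tendsto_cofinite_zero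
  have hfin : {n : ℤ | ¬ ‖a n * t ^ n‖ < 1}.Finite := by
    have := (tendsto_zero_iff_norm_tendsto_zero.mp htend).eventually (gt_mem_nhds zero_lt_one)
    exact this
  obtain ⟨N, hBN, hN⟩ := aux_exists_unit_nat (K := K)
    (hfin.toFinset.sup (fun n => (n - m).natAbs) + 1)
  have hsmall : ∀ n : ℤ, 1 ≤ ‖a n * t ^ n‖ → (n - m).natAbs < N := by
    intro n hn
    have h1 : n ∈ hfin.toFinset := by simpa using hn
    have h2 := Finset.le_sup (f := fun n : ℤ => (n - m).natAbs) h1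
    omega
  have hN0 : (N : K) ≠ 0 := by
    rw [← norm_ne_zero_iff, hN]; exact one_ne_zero
  have : NeZero (N : K) := ⟨hN0⟩
  have hNn : N ≠ 0 := by rintro rfl; simp at hN0
  obtain ⟨ζ, hζ⟩ := HasEnoughRootsOfUnity.exists_primitiveRoot K N
  have hζ1 : ‖ζ‖ = 1 := by
    have : ‖ζ‖ ^ N = 1 := by rw [← norm_pow, hζ.pow_eq_one, norm_one]
    exact (pow_eq_one_iff_of_nonneg (norm_nonneg _) hNn).mp this
  have hζ0 : ζ ≠ 0 := by rw [← norm_ne_zero_iff, hζ1]; exact one_ne_zero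
  set c : ℤ → K := fun n => ∑ j ∈ Finset.range N, (ζ ^ (n - m)) ^ j with hc
  have hcle : ∀ n, ‖c n‖ ≤ 1 := fun n =>
    IsUltrametricDist.norm_sum_le_of_forall_le_of_nonneg zero_le_one fun j _ => by
      simp [norm_pow, norm_zpow, hζ1]
  have hcm : c m = N := by simp [hc]
  have hc0 : ∀ n, n ≠ m → (n - m).natAbs < N → c n = 0 := by
    intro n hn hlt
    have hw : ζ ^ (n - m) ≠ 1 := by
      rw [Ne, hζ.zpow_eq_one_iff_dvd]
      intro hd
      have := Int.natAbs_dvd_natAbs.mpr hd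
      rw [Int.natAbs_natCast] at this
      have := Nat.le_of_dvd (by omega) this
      omega
    have hwN : (ζ ^ (n - m)) ^ N = 1 := by
      rw [← zpow_natCast, ← zpow_mul, mul_comm, zpow_mul, zpow_natCast, hζ.pow_eq_one, one_zpow]
    have := mul_neg_geom_sum (ζ ^ (n - m)) N
    rw [hwN, sub_self] at this
    exact (mul_eq_zero.mp this).resolve_left (sub_ne_zero.mpr (Ne.symm hw))
  have hnj : ∀ j : ℕ, ‖ζ ^ j * t‖ = ‖t‖ := fun j => by simp [hζ1]
  have hS : HasSum (fun n => ∑ j ∈ Finset.range N, (ζ ^ j) ^ (-m) * (a n * (ζ ^ j * t) ^ n))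
      (∑ j ∈ Finset.range N, (ζ ^ j) ^ (-m) * ∑' n : ℤ, a n * (ζ ^ j * t) ^ n) := by
    refine hasSum_sum fun j _ => HasSum.mul_left _ ?_
    exact (hsum _ (by rwa [hnj]) (by rwa [hnj])).hasSum
  have hSle : ‖∑ j ∈ Finset.range N, (ζ ^ j) ^ (-m) * ∑' n : ℤ, a n * (ζ ^ j * t) ^ n‖ ≤ M := by
    refine IsUltrametricDist.norm_sum_le_of_forall_le_of_nonneg hM fun j _ => ?_
    rw [norm_mul, norm_zpow, norm_pow, hζ1, one_pow, one_zpow, one_mul]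
    exact hbd _ (by rwa [hnj]) (by rwa [hnj])
  have hg : (fun n => ∑ j ∈ Finset.range N, (ζ ^ j) ^ (-m) * (a n * (ζ ^ j * t) ^ n))
      = fun n => a n * t ^ n * c n := by
    funext n
    rw [hc, Finset.mul_sum]
    refine Finset.sum_congr rfl fun j _ => ?_
    have : (ζ ^ (n - m)) ^ j = (ζ ^ j) ^ (-m) * (ζ ^ j) ^ n := by
      rw [← zpow_add₀ (pow_ne_zero _ hζ0), ← zpow_natCast, ← zpow_natCast, ← zpow_mul, ← zpow_mul]
      congr 1
      ring
    rw [this, mul_zpow]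
    ring
  rw [hg] at hS
  set S := ∑ j ∈ Finset.range N, (ζ ^ j) ^ (-m) * ∑' n : ℤ, a n * (ζ ^ j * t) ^ n
  have hU := hS.update m 0
  have hUle : ‖0 - a m * t ^ m * c m + S‖ ≤ 1 := by
    rw [← hU.tsum_eq]
    refine IsUltrametricDist.norm_tsum_le_of_forall_le_of_nonneg zero_le_one fun n => ?_
    by_cases hn : n = m
    · subst hn; simp
    · rw [Function.update_of_ne hn]
      by_cases h1 : 1 ≤ ‖a n * t ^ n‖
      · rw [hc0 n hn (hsmall n h1)]; simp
      · rw [norm_mul]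
        exact mul_le_one₀ (not_le.mp h1).le (norm_nonneg _) (hcle n)
  have hfinal : ‖a m * t ^ m‖ = ‖S - (0 - a m * t ^ m * c m + S)‖ := by
    have : S - (0 - a m * t ^ m * c m + S) = a m * t ^ m * c m := by ring
    rw [this, hcm, norm_mul (a m * t ^ m), hN, mul_one]
  rw [hfinal]
  exact (aux_sub_le _ _).trans (max_le_max hSle hUle)

/-- Let `K` be an algebraically closed field, complete with respect to a nontrivial
nonarchimedean multiplicative norm.  If the Laurent series `∑_{n ∈ ℤ} a n * t ^ n` is summable
for every `t` in the punctured open unit disk and its sum is bounded there, then all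
coefficients `a n` with `n < 0` vanish; in particular the function extends to the whole open
unit disk as the everywhere-convergent power series `∑_{n ≥ 0} a n * t ^ n`. -/
theorem bounded_on_punctured_disk_extends
    {K : Type*} [NormedField K] [CompleteSpace K] [IsUltrametricDist K] [IsAlgClosed K]
    (hK : ∃ x : K, 0 < ‖x‖ ∧ ‖x‖ < 1)
    (a : ℤ → K)
    (hsum : ∀ t : K, 0 < ‖t‖ → ‖t‖ < 1 → Summable fun n : ℤ => a n * t ^ n)
    (M : ℝ)
    (hbd : ∀ t : K, 0 < ‖t‖ → ‖t‖ < 1 → ‖∑' n : ℤ, a n * t ^ n‖ ≤ M) :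
    (∀ n : ℤ, n < 0 → a n = 0) ∧
      ∀ t : K, ‖t‖ < 1 →
        (Summable fun n : ℕ => a (n : ℤ) * t ^ n) ∧
          (0 < ‖t‖ → ∑' n : ℤ, a n * t ^ n = ∑' n : ℕ, a (n : ℤ) * t ^ n) := by
  have hneg : ∀ n : ℤ, n < 0 → a n = 0 := by
    intro n hn
    obtain ⟨x, hx0, hx1⟩ := hK
    obtain ⟨k, hk⟩ : ∃ k : ℕ, n = -((k : ℤ) + 1) := ⟨(-n - 1).toNat, by omega⟩
    have hb : ∀ i : ℕ, ‖a n‖ ≤ max M 1 * ‖x‖ ^ i := by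
      intro i
      have hp : 0 < ‖x ^ (i + 1)‖ := by rw [norm_pow]; positivity
      have hp1 : ‖x ^ (i + 1)‖ < 1 := by
        rw [norm_pow]; exact pow_lt_one₀ hx0.le hx1 (by omega)
      have h := aux_cauchy a hsum M hbd (x ^ (i + 1)) hp hp1 n
      rw [norm_mul, norm_zpow] at h
      have hz : ‖x ^ (i + 1)‖ ^ n = (‖x ^ (i + 1)‖ ^ (k + 1))⁻¹ := by
        rw [hk, zpow_neg]; norm_cast
      rw [hz, ← div_eq_mul_inv, div_le_iff₀ (by positivity)] at h
      refine h.trans ?_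
      refine mul_le_mul_of_nonneg_left ?_ (le_max_of_le_right zero_le_one)
      rw [norm_pow, ← pow_mul]
      exact pow_le_pow_of_le_one hx0.le hx1.le (by nlinarith)
    have hlim : Filter.Tendsto (fun i : ℕ => max M 1 * ‖x‖ ^ i) Filter.atTop (nhds 0) := by
      simpa using (tendsto_pow_atTop_nhds_zero_of_lt_one hx0.le hx1).const_mul (max M 1)
    exact norm_le_zero_iff.mp (ge_of_tendsto' hlim hb)
  refine ⟨hneg, fun t ht => ⟨?_, fun ht0 => ?_⟩⟩
  · by_cases h0 : t = 0
    · subst h0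
      refine summable_of_ne_finset_zero (s := {0}) fun n hn => ?_
      have : n ≠ 0 := by simpa using hn
      simp [this]
    · have h := (hsum t (norm_pos_iff.mpr h0) ht).comp_injective
        (i := fun n : ℕ => (n : ℤ)) Nat.cast_injective
      simpa [Function.comp_def] using h
  · have hi : Function.Injective (fun n : ℕ => (n : ℤ)) := Nat.cast_injective
    rw [← hi.tsum_eq (f := fun n : ℤ => a n * t ^ n)]
    · simp
    · intro n hn
      have : ¬ n < 0 := fun h => hn (by simp [hneg n h])
      exact ⟨n.toNat, by simp; omega⟩
end

section
/- Let K be a field complete with respect to a nonarchimedean multiplicative norm |·|, and let t ∈ K with |t| > 1. Then for every integer i ≥ 0 one has t^{2i+1} − 1 ≠ 0 and |(t^{2i+1}+1)/(t^{2i+1}−1) − 1| = |2|/|t|^{2i+1} (where 2 denotes the element 1+1 of K), and the family i ↦ ((t^{2i+1}+1)/(t^{2i+1}−1))^8, indexed by the natural numbers, is multipliable (its finite partial products converge to the infinite product). -/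
/-- For `|t| > 1` in a field complete with respect to a nonarchimedean multiplicative norm, the
factors of the product formula for the cross ratio `λ(t)` of the 2-torsion of the Tate curve
with period `q = t⁻²` satisfy `t^(2i+1) - 1 ≠ 0` and
`‖(t^(2i+1)+1)/(t^(2i+1)-1) - 1‖ = ‖2‖ / ‖t‖^(2i+1)`, and the ℕ-indexed family
`i ↦ ((t^(2i+1)+1)/(t^(2i+1)-1))^8` is multipliable. -/
theorem tate_lambda_factors
    {K : Type*} [NormedField K] [CompleteSpace K] [IsUltrametricDist K]
    (t : K) (ht : 1 < ‖t‖) :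
    (∀ i : ℕ, t ^ (2 * i + 1) - 1 ≠ 0 ∧
        ‖(t ^ (2 * i + 1) + 1) / (t ^ (2 * i + 1) - 1) - 1‖ =
          ‖(2 : K)‖ / ‖t‖ ^ (2 * i + 1)) ∧
      Multipliable fun i : ℕ => ((t ^ (2 * i + 1) + 1) / (t ^ (2 * i + 1) - 1)) ^ 8 := by
  have key : ∀ i : ℕ, t ^ (2 * i + 1) - 1 ≠ 0 ∧
        ‖(t ^ (2 * i + 1) + 1) / (t ^ (2 * i + 1) - 1) - 1‖ =
          ‖(2 : K)‖ / ‖t‖ ^ (2 * i + 1) := by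
    intro i
    have h1 : 1 < ‖t ^ (2 * i + 1)‖ := by
      rw [norm_pow]
      exact one_lt_pow₀ ht (by omega)
    have hn : ‖t ^ (2 * i + 1) - 1‖ = ‖t ^ (2 * i + 1)‖ := by
      have h := IsUltrametricDist.norm_add_eq_max_of_norm_ne_norm
        (x := t ^ (2 * i + 1)) (y := (-1 : K)) (by rw [norm_neg, norm_one]; exact h1.ne')
      rw [← sub_eq_add_neg, norm_neg, norm_one, max_eq_left h1.le] at h
      exact h
    have h0 : t ^ (2 * i + 1) - 1 ≠ 0 := by
      rw [← norm_pos_iff, hn]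
      linarith
    refine ⟨h0, ?_⟩
    have he : (t ^ (2 * i + 1) + 1) / (t ^ (2 * i + 1) - 1) - 1 = 2 / (t ^ (2 * i + 1) - 1) := by
      rw [div_sub_one h0]
      congr 1
      ring
    rw [he, norm_div, hn, norm_pow]
  refine ⟨key, Multipliable.pow ?_ 8⟩
  have hs : Summable fun i : ℕ =>
      ‖(t ^ (2 * i + 1) + 1) / (t ^ (2 * i + 1) - 1) - 1‖ := by
    have hq : ‖t‖⁻¹ ^ 2 < 1 :=
      pow_lt_one₀ (by positivity) (inv_lt_one_of_one_lt₀ ht) (by norm_num)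
    refine ((summable_geometric_of_lt_one (by positivity) hq).mul_left
      (‖(2 : K)‖ * ‖t‖⁻¹)).congr fun i => ?_
    rw [(key i).2, div_eq_mul_inv, ← inv_pow, pow_succ _ (2 * i), pow_mul]
    ring
  have hm := multipliable_one_add_of_summable hs
  simpa using hm
end

section
/- Let K be a field complete with respect to a nonarchimedean multiplicative norm |·|, and let t ∈ K with |t| > 1. Then the ℤ-indexed family i ↦ ((t^{2i+1}+1)/(t^{2i+1}−1))^4 is multipliable, and its product λ(t) = ∏_{i∈ℤ} ((t^{2i+1}+1)/(t^{2i+1}−1))^4 satisfies |λ(t)| = 1. -/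
lemma tate_aux_norm {K : Type*} [NormedField K] [IsUltrametricDist K] (a : K) (ha : ‖a‖ ≠ 1) :
    ‖a + 1‖ = max ‖a‖ 1 ∧ ‖a - 1‖ = max ‖a‖ 1 := by
  constructor
  · simpa using IsUltrametricDist.norm_add_eq_max_of_norm_ne_norm
      (x := a) (y := 1) (by simpa using ha)
  · simpa [sub_eq_add_neg] using IsUltrametricDist.norm_add_eq_max_of_norm_ne_norm
      (x := a) (y := -1) (by simpa using ha)

lemma tate_aux_bound {K : Type*} [NormedField K] [IsUltrametricDist K] (a : K) (ha : ‖a‖ ≠ 1)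
    (h0 : a ≠ 0) :
    ‖((a + 1) / (a - 1)) ^ 4 - 1‖ ≤ ‖a‖ ∧ ‖((a + 1) / (a - 1)) ^ 4 - 1‖ ≤ ‖a‖⁻¹ := by
  obtain ⟨h1, h2⟩ := tate_aux_norm a ha
  have hM : 1 ≤ max ‖a‖ 1 := le_max_right _ _
  have hM' : ‖a‖ ≤ max ‖a‖ 1 := le_max_left _ _
  have hapos : 0 < ‖a‖ := norm_pos_iff.2 h0
  have hne : a - 1 ≠ 0 := by
    rw [← norm_pos_iff, h2]; linarith
  have e : ((a + 1) / (a - 1)) ^ 4 - 1 = (8 : ℕ) * a * (a ^ 2 + 1) / (a - 1) ^ 4 := by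
    field_simp
    push_cast
    ring
  have h8 : ‖((8 : ℕ) : K)‖ ≤ 1 := IsUltrametricDist.norm_natCast_le_one K 8
  have hq : ‖a ^ 2 + 1‖ ≤ (max ‖a‖ 1) ^ 2 := by
    refine (IsUltrametricDist.norm_add_le_max _ _).trans (max_le ?_ ?_)
    · rw [norm_pow]; gcongr
    · rw [norm_one]; exact one_le_pow₀ hM
  have key : ‖((a + 1) / (a - 1)) ^ 4 - 1‖ ≤ ‖a‖ / (max ‖a‖ 1) ^ 2 := by
    rw [e, norm_div, norm_mul, norm_mul, norm_pow, h2]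
    set M := max ‖a‖ 1
    have hMp : 0 < M := by linarith
    calc _ ≤ 1 * ‖a‖ * M ^ 2 / M ^ 4 := by gcongr
      _ = _ := by field_simp
  refine ⟨key.trans ?_, key.trans ?_⟩
  · exact div_le_self hapos.le (one_le_pow₀ hM)
  · rw [div_le_iff₀ (by positivity), inv_mul_eq_div, le_div_iff₀ hapos, ← sq]
    gcongr

/-- For `|t| > 1` in a field complete with respect to a nonarchimedean multiplicative norm, the
ℤ-indexed family `i ↦ ((t^(2i+1)+1)/(t^(2i+1)-1))^4` is multipliable, and its infinite product,
the cross ratio `λ(t)` of the 2-torsion points of the Tate curve with period `q = t⁻²`,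
has norm `1`. -/
theorem tate_lambda_multipliable_and_norm_one
    {K : Type*} [NormedField K] [CompleteSpace K] [IsUltrametricDist K]
    (t : K) (ht : 1 < ‖t‖) :
    (Multipliable fun i : ℤ => ((t ^ (2 * i + 1) + 1) / (t ^ (2 * i + 1) - 1)) ^ 4) ∧
      ‖∏' i : ℤ, ((t ^ (2 * i + 1) + 1) / (t ^ (2 * i + 1) - 1)) ^ 4‖ = 1 := by
  have ht0 : t ≠ 0 := norm_pos_iff.1 (by linarith)
  have hn1 : ∀ i : ℤ, ‖t ^ (2 * i + 1)‖ ≠ 1 := by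
    intro i h
    rw [norm_zpow, zpow_eq_one_iff_right₀ (by linarith) (by linarith)] at h
    omega
  have hgeo : Summable fun n : ℕ => (‖t‖⁻¹) ^ n :=
    summable_geometric_of_lt_one (by positivity) (inv_lt_one_of_one_lt₀ ht)
  have hle : ∀ n : ℕ, ‖t‖ ^ (-(2 * (n : ℤ) + 1)) ≤ (‖t‖⁻¹) ^ n := by
    intro n
    rw [inv_pow, ← zpow_natCast, ← zpow_neg]
    exact zpow_le_zpow_right₀ ht.le (by omega)
  have hs : Summable fun i : ℤ =>
      ‖((t ^ (2 * i + 1) + 1) / (t ^ (2 * i + 1) - 1)) ^ 4 - 1‖ := by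
    apply Summable.of_nat_of_neg_add_one
    · refine Summable.of_nonneg_of_le (fun _ => norm_nonneg _) (fun n => ?_) hgeo
      refine (tate_aux_bound _ (hn1 n) (zpow_ne_zero _ ht0)).2.trans ?_
      rw [norm_zpow, ← zpow_neg]
      exact hle n
    · refine Summable.of_nonneg_of_le (fun _ => norm_nonneg _) (fun n => ?_) hgeo
      refine (tate_aux_bound _ (hn1 (-(n + 1))) (zpow_ne_zero _ ht0)).1.trans ?_
      rw [norm_zpow]
      rw [show 2 * (-((n : ℤ) + 1)) + 1 = -(2 * (n : ℤ) + 1) by ring]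
      exact hle n
  have hm : Multipliable fun i : ℤ => ((t ^ (2 * i + 1) + 1) / (t ^ (2 * i + 1) - 1)) ^ 4 := by
    simpa using multipliable_one_add_of_summable hs
  refine ⟨hm, ?_⟩
  have hlim := hm.hasProd.norm
  have hone : ∀ i : ℤ, ‖((t ^ (2 * i + 1) + 1) / (t ^ (2 * i + 1) - 1)) ^ 4‖ = 1 := by
    intro i
    obtain ⟨h1, h2⟩ := tate_aux_norm _ (hn1 i)
    rw [norm_pow, norm_div, h1, h2, div_self, one_pow]
    exact (lt_of_lt_of_le one_pos (le_max_right _ _)).ne'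
  simp only [hone] at hlim
  exact hlim.unique hasProd_one
end

section
/- Let K be a field with a nonarchimedean multiplicative norm |·|, and let λ ∈ K with λ ≠ 0, λ ≠ 1, satisfying the Mumford conditions |λ| = 1 and |1−λ| < |2|^2 (where 2 = 1+1 in K). Then among the six values λ, λ^{−1}, 1−λ, (λ−1)^{−1}, λ(λ−1)^{−1}, (λ−1)λ^{−1} with the same j-invariant, exactly λ and λ^{−1} satisfy the Mumford conditions: λ^{−1} satisfies |λ^{−1}| = 1 and |1−λ^{−1}| < |2|^2, while none of 1−λ, (λ−1)^{−1}, λ(λ−1)^{−1}, (λ−1)λ^{−1} satisfies both conditions. -/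
/-- Let `λ` satisfy the Mumford conditions `‖λ‖ = 1` and `‖1-λ‖ < ‖2‖²` in a field with a
nonarchimedean multiplicative norm.  Among the six values `λ, λ⁻¹, 1-λ, (λ-1)⁻¹, λ(λ-1)⁻¹,
(λ-1)λ⁻¹` with the same `j`-invariant, exactly `λ` and `λ⁻¹` satisfy the Mumford conditions. -/
theorem mumford_conditions_orbit
    {K : Type*} [NormedField K] [IsUltrametricDist K]
    (lam : K) (h0 : lam ≠ 0) (h1 : lam ≠ 1)
    (hm1 : ‖lam‖ = 1) (hm2 : ‖1 - lam‖ < ‖(2 : K)‖ ^ 2) :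
    (‖lam⁻¹‖ = 1 ∧ ‖1 - lam⁻¹‖ < ‖(2 : K)‖ ^ 2) ∧
      ¬(‖1 - lam‖ = 1 ∧ ‖1 - (1 - lam)‖ < ‖(2 : K)‖ ^ 2) ∧
      ¬(‖(lam - 1)⁻¹‖ = 1 ∧ ‖1 - (lam - 1)⁻¹‖ < ‖(2 : K)‖ ^ 2) ∧
      ¬(‖lam * (lam - 1)⁻¹‖ = 1 ∧ ‖1 - lam * (lam - 1)⁻¹‖ < ‖(2 : K)‖ ^ 2) ∧
      ¬(‖(lam - 1) * lam⁻¹‖ = 1 ∧ ‖1 - (lam - 1) * lam⁻¹‖ < ‖(2 : K)‖ ^ 2) := by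
  have h2 : ‖(2 : K)‖ ≤ 1 := by
    simpa using IsUltrametricDist.norm_natCast_le_one K 2
  have hlt : ‖1 - lam‖ < 1 := hm2.trans_le (pow_le_one₀ (norm_nonneg _) h2)
  have hlt' : ‖lam - 1‖ < 1 := by rwa [norm_sub_rev]
  refine ⟨⟨by simp [hm1], ?_⟩, ?_, ?_, ?_, ?_⟩
  · have e : 1 - lam⁻¹ = (lam - 1) * lam⁻¹ := by field_simp
    rw [e, norm_mul, norm_inv, hm1, inv_one, mul_one, norm_sub_rev]
    exact hm2
  · rintro ⟨h, -⟩
    exact hlt.ne h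
  · rintro ⟨h, -⟩
    rw [norm_inv, inv_eq_one] at h
    exact hlt'.ne h
  · rintro ⟨h, -⟩
    rw [norm_mul, norm_inv, hm1, one_mul, inv_eq_one] at h
    exact hlt'.ne h
  · rintro ⟨h, -⟩
    rw [norm_mul, norm_inv, hm1, inv_one, mul_one] at h
    exact hlt'.ne h
end

section
/- Let K be a field with a nonarchimedean multiplicative norm |·|, and let t₁, t₂ ∈ K with |t₁| > 1 and |t₂| > 1. In PGL(2,K), let Γ(t₁) and Γ(t₂) be the cyclic subgroups generated by the classes of the diagonal matrices diag(1, t₁²) and diag(1, t₂²) respectively. Then Γ(t₁) and Γ(t₂) are conjugate subgroups of PGL(2,K) if and only if t₁ = t₂ or t₁ = −t₂. -/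
/-- The projective general linear group `PGL(2,K)`: the quotient of `GL(2,K)` by its center
(the nonzero scalar matrices). -/
abbrev PGL2 (K : Type*) [Field K] :=
  Matrix.GeneralLinearGroup (Fin 2) K ⧸
    Subgroup.center (Matrix.GeneralLinearGroup (Fin 2) K)

/-- The class in `PGL(2,K)` of a 2×2 matrix with nonzero determinant. -/
noncomputable def pgl2 {K : Type*} [Field K] (A : Matrix (Fin 2) (Fin 2) K)
    (h : A.det ≠ 0) : PGL2 K :=
  QuotientGroup.mk (Matrix.GeneralLinearGroup.mkOfDetNeZero A h)

noncomputable def dMat (K : Type*) [Field K] : K →* Matrix (Fin 2) (Fin 2) K where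
  toFun x := !![1, 0; 0, x]
  map_one' := by rw [Matrix.one_fin_two]
  map_mul' x y := by simp

noncomputable def dHom (K : Type*) [Field K] : Kˣ →* PGL2 K :=
  (QuotientGroup.mk' _).comp (Units.map (dMat K))

lemma pgl2_eq_dHom {K : Type*} [Field K] (a : Kˣ) (h : (!![1, 0; 0, (a : K)]).det ≠ 0) :
    pgl2 !![1, 0; 0, (a : K)] h = dHom K a := by
  unfold pgl2 dHom
  simp only [MonoidHom.comp_apply, QuotientGroup.mk'_apply]
  congr 1
  ext i j
  rfl

lemma exists_smul_of_mk_eq {K : Type*} [Field K] (x y : Matrix.GeneralLinearGroup (Fin 2) K)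
    (h : (QuotientGroup.mk x : PGL2 K) = QuotientGroup.mk y) :
    ∃ l : K, (y : Matrix (Fin 2) (Fin 2) K) = l • (x : Matrix (Fin 2) (Fin 2) K) := by
  rw [QuotientGroup.eq, Matrix.GeneralLinearGroup.center_eq_range_scalar] at h
  obtain ⟨u, hu⟩ := h
  refine ⟨u, ?_⟩
  have : y = x * Matrix.GeneralLinearGroup.scalar (Fin 2) u := by rw [hu]; group
  rw [this]
  ext i j
  fin_cases i <;> fin_cases j <;> simp [Matrix.mul_apply, Fin.sum_univ_two, mul_comm]

lemma conj_eq {K : Type*} [Field K] (a c : Kˣ) (g : PGL2 K)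
    (h : g * dHom K a * g⁻¹ = dHom K c) : c = a ∨ c⁻¹ = a := by
  have h' : dHom K c * g = g * dHom K a := by rw [← h]; group
  induction g using QuotientGroup.induction_on with
  | H g =>
  obtain ⟨l, hl⟩ := exists_smul_of_mk_eq (Units.map (dMat K) c * g) (g * Units.map (dMat K) a) h'
  have hd : (g : Matrix (Fin 2) (Fin 2) K).det ≠ 0 := g.det.ne_zero
  rw [Matrix.det_fin_two] at hd
  have e := fun i j => congrFun (congrFun hl i) j
  have e00 := e 0 0
  have e01 := e 0 1
  have e10 := e 1 0
  have e11 := e 1 1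
  simp [Matrix.mul_apply, Matrix.vecMul, dotProduct, Fin.sum_univ_two, dMat] at e00 e01 e10 e11
  generalize (g : Matrix (Fin 2) (Fin 2) K) 0 0 = p at *
  generalize (g : Matrix (Fin 2) (Fin 2) K) 0 1 = q at *
  generalize (g : Matrix (Fin 2) (Fin 2) K) 1 0 = r at *
  generalize (g : Matrix (Fin 2) (Fin 2) K) 1 1 = s at *
  have hc := c.ne_zero
  clear h h' hl e
  by_cases hps : p * s = 0
  · right
    have hq : q ≠ 0 := by rintro rfl; simp [hps] at hd
    have hr : r ≠ 0 := by rintro rfl; simp [hps] at hd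
    rw [inv_eq_iff_mul_eq_one]
    ext
    push_cast
    grind
  · left
    ext
    grind

lemma exists_zpow {K : Type*} [Field K] (a b : Kˣ) (g : PGL2 K)
    (h : g * dHom K a * g⁻¹ ∈ Subgroup.zpowers (dHom K b)) : ∃ n : ℤ, a = b ^ n := by
  obtain ⟨n, hn⟩ := h
  have hn' : dHom K b ^ n = g * dHom K a * g⁻¹ := hn
  rw [← map_zpow] at hn'
  rcases conj_eq a (b ^ n) g hn'.symm with h | h
  · exact ⟨n, h.symm⟩
  · exact ⟨-n, by rw [zpow_neg, h]⟩

lemma units_eq {K : Type*} [NormedField K] (a b : Kˣ) (ha : 1 < ‖(a : K)‖) (hb : 1 < ‖(b : K)‖)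
    (n m : ℤ) (h : a = b ^ n) (h' : b = a ^ m) : a = b := by
  have e : a ^ (1 : ℤ) = a ^ (m * n) := by rw [zpow_mul, ← h', ← h, zpow_one]
  have e2 : ‖(a : K)‖ ^ (1 : ℤ) = ‖(a : K)‖ ^ (m * n) := by
    rw [← norm_zpow, ← norm_zpow, ← Units.val_zpow_eq_zpow_val, ← Units.val_zpow_eq_zpow_val, e]
  have e3 := zpow_right_injective₀ (zero_lt_one.trans ha) ha.ne' e2
  rcases Int.eq_one_or_neg_one_of_mul_eq_one' e3.symm with ⟨_, hn⟩ | ⟨_, hn⟩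
  · rw [h, hn, zpow_one]
  · exfalso
    subst hn
    rw [h] at ha
    simp only [zpow_neg, zpow_one, Units.val_inv_eq_inv_val, norm_inv] at ha
    exact absurd (inv_lt_one_of_one_lt₀ hb) ha.le.not_gt

/-- The cyclic subgroups of `PGL(2,K)` generated by the classes of `diag(1,t₁²)` and
`diag(1,t₂²)`, for `|t₁| > 1` and `|t₂| > 1`, are conjugate in `PGL(2,K)` if and only if
`t₁ = t₂` or `t₁ = -t₂`.  (These groups uniformize the Tate curves with periods `tᵢ⁻²`.) -/
theorem tate_schottky_conjugate_iff
    {K : Type*} [NormedField K] [IsUltrametricDist K]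
    (t₁ t₂ : K) (h₁ : 1 < ‖t₁‖) (h₂ : 1 < ‖t₂‖) :
    (∃ g : PGL2 K,
        Subgroup.map (MulAut.conj g).toMonoidHom
            (Subgroup.zpowers (pgl2 !![1, 0; 0, t₁ ^ 2]
              (by simpa [Matrix.det_fin_two_of] using
                pow_ne_zero 2 (norm_pos_iff.mp (zero_lt_one.trans h₁))))) =
          Subgroup.zpowers (pgl2 !![1, 0; 0, t₂ ^ 2]
            (by simpa [Matrix.det_fin_two_of] using
              pow_ne_zero 2 (norm_pos_iff.mp (zero_lt_one.trans h₂)))))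
      ↔ t₁ = t₂ ∨ t₁ = -t₂ := by
  have n₁ : t₁ ≠ 0 := norm_pos_iff.mp (zero_lt_one.trans h₁)
  have n₂ : t₂ ≠ 0 := norm_pos_iff.mp (zero_lt_one.trans h₂)
  obtain ⟨a, ha⟩ : ∃ a : Kˣ, (a : K) = t₁ ^ 2 := ⟨Units.mk0 _ (pow_ne_zero 2 n₁), rfl⟩
  obtain ⟨b, hb⟩ : ∃ b : Kˣ, (b : K) = t₂ ^ 2 := ⟨Units.mk0 _ (pow_ne_zero 2 n₂), rfl⟩
  have na : 1 < ‖(a : K)‖ := by rw [ha, norm_pow]; exact one_lt_pow₀ h₁ two_ne_zero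
  have nb : 1 < ‖(b : K)‖ := by rw [hb, norm_pow]; exact one_lt_pow₀ h₂ two_ne_zero
  rw [← sq_eq_sq_iff_eq_or_eq_neg]
  simp only [← ha, ← hb, pgl2_eq_dHom, Units.val_inj]
  constructor
  · rintro ⟨g, hg⟩
    rw [MonoidHom.map_zpowers] at hg
    obtain ⟨n, hn⟩ := exists_zpow a b g (by
      rw [← hg]; exact Subgroup.mem_zpowers _)
    obtain ⟨m, hm⟩ := exists_zpow b a g⁻¹ (by
      have h : dHom K b ∈ Subgroup.zpowers ((MulAut.conj g).toMonoidHom (dHom K a)) := by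
        rw [hg]; exact Subgroup.mem_zpowers _
      obtain ⟨k, hk⟩ := h
      refine ⟨k, ?_⟩
      have hk' : (MulAut.conj g).toMonoidHom (dHom K a) ^ k = dHom K b := hk
      rw [← map_zpow] at hk'
      rw [← hk']
      simp [mul_assoc])
    exact units_eq a b na nb n m hn hm
  · rintro rfl
    exact ⟨1, by simp⟩
end

section
/- Let p be a prime, q = p^m with q > 2, and let K be a field of characteristic p containing the finite field F_q. Let λ₁, λ₂ ∈ K be nonzero, and for i = 1,2 let B_{λ_i} = K[X,Y]/((X^q − X)(Y^q − Y) − λ_i), which is an integral domain, with fraction field F_{λ_i} = Frac(B_{λ_i}) (the function field of the Artin–Schreier–Mumford curve X_{λ_i}). Then there exists a K-algebra isomorphism F_{λ₁} ≅ F_{λ₂} if and only if λ₁/λ₂ ∈ F_q^*, i.e. if and only if λ₁ = ζλ₂ for some nonzero ζ ∈ F_q. -/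
set_option synthInstance.maxHeartbeats 1000000
set_option maxHeartbeats 1000000

/-- The defining polynomial `(X^q − X)(Y^q − Y) − μ` of the affine Artin–Schreier–Mumford
curve. -/
noncomputable def asmPoly (K : Type*) [Field K] (q : ℕ) (μ : K) : MvPolynomial (Fin 2) K :=
  (MvPolynomial.X 0 ^ q - MvPolynomial.X 0) * (MvPolynomial.X 1 ^ q - MvPolynomial.X 1) -
    MvPolynomial.C μ

/-- The affine coordinate ring `K[X,Y]/((X^q − X)(Y^q − Y) − μ)` of the
Artin–Schreier–Mumford curve `X_μ`. -/
abbrev asmRing (K : Type*) [Field K] (q : ℕ) (μ : K) :=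
  MvPolynomial (Fin 2) K ⧸ Ideal.span {asmPoly K q μ}
open scoped WithZero

/-- A field with a valuation and a derivation, modelled on Laurent series. -/
structure AsmPlace (q : ℕ) (L M : Type*) [Field L] [Field M] [Algebra L M] where
  v : Valuation M ℤᵐ⁰
  δ : Derivation L M M
  t : M
  t_ne : t ≠ 0
  t_lt : v t < 1
  δt : δ t = 1
  δO : ∀ z, v z ≤ 1 → v (δ z) ≤ 1
  const : ∀ l : L, v (algebraMap L M l) ≤ 1
  solve : ∀ c : M, v c ≤ 1 → ∀ α : L, v (c - algebraMap L M (α ^ q - α)) < 1 →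
    ∃ y : M, y ^ q - y = c ∧ v (y - algebraMap L M α) < 1
  res : ∀ z, v z ≤ 1 → ∃ l : L, v (z - algebraMap L M l) < 1

section LaurentPlace
open PowerSeries

theorem asm_exists_der (L M : Type*) [Field L] [Field M] [Algebra (PowerSeries L) M]
    [IsFractionRing (PowerSeries L) M] [Algebra L M] [IsScalarTower L (PowerSeries L) M] :
    ∃ δ : Derivation L M M,
    ∀ f : PowerSeries L, δ (algebraMap _ _ f) = algebraMap _ _ (d⁄dX L f) := by
  let ψ : PowerSeries L →+* DualNumber M :=
    { toFun := fun f => TrivSqZeroExt.inl (algebraMap _ M f) +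
        TrivSqZeroExt.inr (algebraMap _ M (d⁄dX L f))
      map_one' := by ext <;> simp
      map_zero' := by ext <;> simp
      map_add' := by intro a b; ext <;> simp [Algebra.smul_def]
      map_mul' := by
        intro a b
        ext
        · simp
        · simp [Derivation.leibniz, mul_comm, Algebra.smul_def, TrivSqZeroExt.algebraMap_eq_inl] }
  have hu : ∀ y : nonZeroDivisors (PowerSeries L), IsUnit (ψ y) := by
    intro y
    rw [TrivSqZeroExt.isUnit_iff_isUnit_fst]
    have : (algebraMap (PowerSeries L) M y) ≠ 0 :=
      IsFractionRing.to_map_ne_zero_of_mem_nonZeroDivisors y.2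
    have h2 : (ψ y).fst = algebraMap (PowerSeries L) M y := by simp [ψ]
    rw [h2]
    exact this.isUnit
  let Ψ : M →+* DualNumber M := IsLocalization.lift hu
  have hΨ : ∀ f, Ψ (algebraMap _ M f) = ψ f := fun f => IsLocalization.lift_eq hu f
  have hfst : ∀ z, (Ψ z).fst = z := by
    have : ((TrivSqZeroExt.fstHom M M M).toRingHom.comp Ψ) = RingHom.id M := by
      apply IsLocalization.ringHom_ext (nonZeroDivisors (PowerSeries L))
      ext1 f
      simp [hΨ, ψ]
    intro z
    exact congrArg (fun g : M →+* M => g z) this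
  have hC : ∀ l : L, algebraMap L M l = algebraMap (PowerSeries L) M (C l) :=
    fun l => IsScalarTower.algebraMap_apply L (PowerSeries L) M l
  have hΨC : ∀ l : L, Ψ (algebraMap L M l) = TrivSqZeroExt.inl (algebraMap L M l) := by
    intro l
    rw [hC, hΨ]
    ext <;> simp [ψ]
  refine ⟨Derivation.mk' { toFun := fun z => (Ψ z).snd, map_add' := ?_, map_smul' := ?_ } ?_, ?_⟩
  · intro a b; simp
  · intro l z
    rw [Algebra.smul_def, map_mul, hΨC]
    simp [Algebra.smul_def]
  · intro a b
    simp [hfst]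
    exact mul_comm _ _
  · intro f
    change (Ψ _).snd = _
    rw [hΨ]
    simp [ψ, Algebra.smul_def, TrivSqZeroExt.algebraMap_eq_inl]

theorem asm_henselAS (L : Type*) [Field L] (p m q : ℕ) [CharP L p] (hp : p.Prime) (hm : 0 < m)
    (hq : q = p ^ m) (c : PowerSeries L) (α : L) (h : constantCoeff c = α ^ q - α) :
    ∃ y : PowerSeries L, y ^ q - y = c ∧ constantCoeff y = α := by
  have hen : HenselianRing (PowerSeries L) (Ideal.span {X}) := inferInstance
  have hq1 : 1 < q := by rw [hq]; exact Nat.one_lt_pow hm.ne' hp.one_lt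
  have hqL : (q : PowerSeries L) = 0 := by
    have : (q : L) = 0 := by rw [hq]; push_cast; rw [CharP.cast_eq_zero]; simp [hm.ne']
    have h2 := congrArg (C (R := L)) this
    simpa using h2
  let f : Polynomial (PowerSeries L) := Polynomial.X ^ q - Polynomial.X - Polynomial.C c
  have hmon : f.Monic := by
    have : f = Polynomial.X ^ q - (Polynomial.X + Polynomial.C c) := by simp [f]; ring
    rw [this]
    apply Polynomial.monic_X_pow_sub
    rw [Polynomial.degree_X_add_C]
    exact_mod_cast hq1
  obtain ⟨a, ha, hb⟩ := HenselianRing.is_henselian (I := Ideal.span {X}) f hmon (C α)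
    (by
      rw [Ideal.mem_span_singleton, PowerSeries.X_dvd_iff]
      simp [f, h])
    (by
      have : (Polynomial.derivative f).eval (C α) = -1 := by
        simp [f, Polynomial.derivative_X_pow, hqL]
      rw [this]
      simp)
  refine ⟨a, ?_, ?_⟩
  · have : a ^ q - a - c = 0 := by simpa [f, Polynomial.IsRoot] using ha
    linear_combination this
  · rw [Ideal.mem_span_singleton, PowerSeries.X_dvd_iff] at hb
    simp at hb
    linear_combination hb

theorem asm_exists_place (L M : Type*) [Field L] [Field M] [Algebra (PowerSeries L) M]
    [IsFractionRing (PowerSeries L) M] [Algebra L M] [IsScalarTower L (PowerSeries L) M]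
    (p m q : ℕ) [CharP L p] (hp : p.Prime) (hm : 0 < m)
    (hq : q = p ^ m) : Nonempty (AsmPlace q L M) := by
  obtain ⟨δ, hδ⟩ := asm_exists_der L M
  have hC : ∀ l : L, algebraMap L M l = algebraMap (PowerSeries L) M (C l) :=
    fun l => IsScalarTower.algebraMap_apply L (PowerSeries L) M l
  let v : Valuation M ℤᵐ⁰ := (PowerSeries.idealX L).valuation M
  have hO : ∀ f, v (algebraMap (PowerSeries L) M f) ≤ 1 := fun f =>
    IsDedekindDomain.HeightOneSpectrum.valuation_le_one _ f
  have hlt : ∀ f : PowerSeries L, v (algebraMap _ M f) < (1 : ℤᵐ⁰) ↔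
      constantCoeff f = 0 := by
    intro f
    rw [IsDedekindDomain.HeightOneSpectrum.valuation_lt_one_iff_mem]
    change f ∈ Ideal.span {X} ↔ _
    rw [Ideal.mem_span_singleton, PowerSeries.X_dvd_iff]
  have hle : ∀ z : M, v z ≤ (1 : ℤᵐ⁰) ↔ ∃ f : PowerSeries L, algebraMap _ _ f = z := by
    intro z
    constructor
    · intro hz
      rcases ValuationRing.isInteger_or_isInteger (PowerSeries L) z with h | ⟨f, hf⟩
      · exact h
      · by_cases h0 : z = 0
        · exact ⟨0, by simp [h0]⟩
        have hf0 : ¬ constantCoeff f = 0 := by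
          rw [← hlt, hf, map_inv₀, not_lt]
          exact (one_le_inv₀ (by simpa [zero_lt_iff] using h0)).2 hz
        refine ⟨f⁻¹, ?_⟩
        have h1 : f * f⁻¹ = 1 := PowerSeries.mul_inv_cancel f hf0
        have h2 := congrArg (algebraMap _ M) h1
        rw [map_mul, map_one, hf] at h2
        exact (eq_inv_of_mul_eq_one_right h2).trans (inv_inv z)
    · rintro ⟨f, rfl⟩
      exact hO f
  refine ⟨{ v := v, δ := δ, t := algebraMap _ _ X, t_ne := ?_, t_lt := (hlt _).2 (by simp), δt := ?_,
            δO := ?_, const := ?_, solve := ?_, res := ?_ }⟩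
  · exact (map_ne_zero_iff _ (IsFractionRing.injective (PowerSeries L) _)).2 PowerSeries.X_ne_zero
  · rw [hδ]; simp
  · intro z hz
    obtain ⟨f, rfl⟩ := (hle z).1 hz
    rw [hδ]
    exact (hle _).2 ⟨_, rfl⟩
  · intro l
    rw [hC]
    exact (hle _).2 ⟨_, rfl⟩
  · intro c hc α h
    obtain ⟨f, rfl⟩ := (hle c).1 hc
    rw [hC, ← map_sub, hlt] at h
    obtain ⟨y, hy, hy0⟩ := asm_henselAS L p m q hp hm hq f α (by
      simp at h
      linear_combination h)
    refine ⟨algebraMap _ _ y, ?_, ?_⟩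
    · rw [← hy]; simp only [map_sub, map_pow]
    · rw [hC, ← map_sub, hlt]; simp [hy0]
  · intro z hz
    obtain ⟨f, rfl⟩ := (hle z).1 hz
    refine ⟨constantCoeff f, ?_⟩
    rw [hC, ← map_sub, hlt]
    simp
end LaurentPlace


theorem asm_mul_lt {a b : ℤᵐ⁰} (ha : a ≤ 1) (hb : b < 1) : a * b < 1 :=
  mul_lt_one_of_nonneg_of_lt_one_right ha zero_le hb

namespace AsmPlace
variable {q : ℕ} {L M : Type*} [Field L] [Field M] [Algebra L M] (P : AsmPlace q L M)

theorem v_const {l : L} (hl : l ≠ 0) : P.v (algebraMap L M l) = 1 := by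
  apply le_antisymm (P.const l)
  have h := P.const l⁻¹
  rw [map_inv₀, map_inv₀] at h
  have h0 : P.v (algebraMap L M l) ≠ 0 := by simpa using hl
  exact (inv_le_one₀ (zero_lt_iff.2 h0)).1 h

theorem v_le_of_close {z : M} {α : L} (h : P.v (z - algebraMap L M α) < 1) : P.v z ≤ 1 := by
  have : z = (z - algebraMap L M α) + algebraMap L M α := by ring
  rw [this]
  exact (P.v.map_add _ _).trans (max_le h.le (P.const α))

theorem close_aeval {z : M} {α : L} (h : P.v (z - algebraMap L M α) < 1) (f : Polynomial L) :
    P.v (Polynomial.aeval z f - algebraMap L M (f.eval α)) < 1 := by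
  have hz := P.v_le_of_close h
  induction f using Polynomial.induction_on' with
  | add f g hf hg =>
    have : Polynomial.aeval z (f + g) - algebraMap L M ((f + g).eval α) =
      (Polynomial.aeval z f - algebraMap L M (f.eval α)) +
      (Polynomial.aeval z g - algebraMap L M (g.eval α)) := by simp; ring
    rw [this]
    exact P.v.map_add_lt hf hg
  | monomial n a =>
    have key : ∀ n : ℕ, P.v (z ^ n - (algebraMap L M α) ^ n) < 1 := by
      intro n
      induction n with
      | zero => simp
      | succ n ih =>
        have : z ^ (n + 1) - (algebraMap L M α) ^ (n + 1) =
          z ^ n * (z - algebraMap L M α) +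
            algebraMap L M α * (z ^ n - (algebraMap L M α) ^ n) := by ring
        rw [this]
        apply P.v.map_add_lt
        · rw [map_mul, map_pow]
          exact asm_mul_lt (pow_le_one₀ zero_le hz) h
        · rw [map_mul]
          exact asm_mul_lt (P.const α) ih
    have : Polynomial.aeval z (Polynomial.monomial n a) -
        algebraMap L M ((Polynomial.monomial n a).eval α) =
        algebraMap L M a * (z ^ n - (algebraMap L M α) ^ n) := by
      simp [Polynomial.aeval_monomial]; ring
    rw [this, map_mul]
    exact asm_mul_lt (P.const a) (key n)

theorem v_aeval_eq_one {z : M} {α : L} (h : P.v (z - algebraMap L M α) < 1) (f : Polynomial L)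
    (hf : f.eval α ≠ 0) : P.v (Polynomial.aeval z f) = 1 := by
  have h1 := P.close_aeval h f
  have h2 := P.v_const hf
  have : Polynomial.aeval z f = (Polynomial.aeval z f - algebraMap L M (f.eval α)) +
    algebraMap L M (f.eval α) := by ring
  rw [this, P.v.map_add_eq_of_lt_right (by rw [h2]; exact h1), h2]

theorem v_aeval_lt_one {z : M} {α : L} (h : P.v (z - algebraMap L M α) < 1) (f : Polynomial L)
    (hf : f.eval α = 0) : P.v (Polynomial.aeval z f) < 1 := by
  have h1 := P.close_aeval h f
  rw [hf] at h1
  simpa using h1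

theorem v_integral {z : M} (h : IsIntegral L z) : P.v z ≤ 1 := by
  let i : L →+* P.v.integer := (algebraMap L M).codRestrict P.v.integer (fun l => P.const l)
  obtain ⟨f, hf, hz⟩ := h
  by_contra hlt
  rw [not_le] at hlt
  have hInteg : IsIntegral P.v.integer z := by
    refine ⟨f.map i, hf.map i, ?_⟩
    rw [Polynomial.eval₂_map]
    exact hz
  exact absurd ((Valuation.integer.integers P.v).mem_of_integral hInteg) (not_le.2 hlt)

theorem transcendental_of_lt {z : M} (h0 : z ≠ 0) (h : P.v z < 1) : Transcendental L z := by
  intro hz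
  have := P.v_integral (z := z⁻¹) hz.isIntegral.inv
  rw [map_inv₀] at this
  have h0' : P.v z ≠ 0 := by simpa using h0
  exact absurd ((inv_le_one₀ (zero_lt_iff.2 h0')).1 this) (not_le.2 h)

theorem v_t_pow (hq : 1 < q) : P.v (1 - P.t ^ (q - 1)) = 1 := by
  have h : P.v (P.t ^ (q - 1)) < 1 := by
    rw [map_pow]
    exact pow_lt_one₀ zero_le P.t_lt (by omega)
  have := P.v.map_sub_eq_of_lt_left (x := 1) (y := P.t ^ (q - 1)) (by simpa using h)
  simpa using this

theorem inv_t (hq : 1 < q) : P.t⁻¹ ^ q - P.t⁻¹ = (1 - P.t ^ (q - 1)) / P.t ^ q := by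
  have ht := P.t_ne
  have : P.t ^ q = P.t ^ (q - 1) * P.t := by rw [← pow_succ]; congr 1; omega
  rw [inv_pow, this]
  field_simp

theorem v_inv_t (hq : 1 < q) : P.v (P.t⁻¹ ^ q - P.t⁻¹) = (P.v P.t ^ q)⁻¹ := by
  rw [P.inv_t hq, map_div₀, P.v_t_pow hq, map_pow, one_div]

/-- A point of the curve at which one coordinate is infinite. -/
theorem exists_inf (hq : 1 < q) (lam : L) (α : L) (hα : α ^ q = α) :
    ∃ y : M, (P.t⁻¹ ^ q - P.t⁻¹) * (y ^ q - y) = algebraMap L M lam ∧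
      P.v (y - algebraMap L M α) < 1 := by
  have hv := P.v_inv_t hq
  have ht : P.v P.t ≠ 0 := by simpa using P.t_ne
  have hne : P.t⁻¹ ^ q - P.t⁻¹ ≠ 0 := by
    intro h
    rw [h, map_zero] at hv
    exact inv_ne_zero (pow_ne_zero q ht) hv.symm
  have hc : P.v (algebraMap L M lam / (P.t⁻¹ ^ q - P.t⁻¹)) < 1 := by
    rw [map_div₀, hv, div_inv_eq_mul]
    exact asm_mul_lt (P.const lam) (pow_lt_one₀ zero_le P.t_lt (by omega))
  obtain ⟨y, hy, hy'⟩ := P.solve _ hc.le α (by simpa [hα] using hc)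
  refine ⟨y, ?_, hy'⟩
  rw [hy]
  exact mul_div_cancel₀ _ hne

theorem exists_fin [IsAlgClosed L] (hq : 1 < q) (lam : L) (α : L) (hα : α ^ q ≠ α) :
    ∃ y : M, ((algebraMap L M α + P.t) ^ q - (algebraMap L M α + P.t)) * (y ^ q - y) =
      algebraMap L M lam := by
  have hcl : P.v ((algebraMap L M α + P.t) - algebraMap L M α) < 1 := by
    simpa using P.t_lt
  have hu := P.v_aeval_eq_one hcl (Polynomial.X ^ q - Polynomial.X)
    (by simpa [sub_eq_zero] using hα)
  simp only [map_sub, map_pow, Polynomial.aeval_X] at hu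
  set u := (algebraMap L M α + P.t) ^ q - (algebraMap L M α + P.t) with hudef
  have hne : u ≠ 0 := by
    intro h
    rw [h, map_zero] at hu
    exact zero_ne_one hu
  have hc : P.v (algebraMap L M lam / u) ≤ 1 := by
    rw [map_div₀, hu, div_one]
    exact P.const lam
  obtain ⟨l, hl⟩ := P.res _ hc
  have hmon : (Polynomial.X ^ q - (Polynomial.X + Polynomial.C l) : Polynomial L).degree = q := by
    rw [Polynomial.degree_sub_eq_left_of_degree_lt]
    · simp
    · rw [Polynomial.degree_X_add_C, Polynomial.degree_X_pow]
      exact_mod_cast hq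
  obtain ⟨β, hβ⟩ := IsAlgClosed.exists_root
    (Polynomial.X ^ q - (Polynomial.X + Polynomial.C l) : Polynomial L) (by
      rw [hmon]; exact_mod_cast (by omega))
  have hβ' : β ^ q - β = l := by
    simp [Polynomial.IsRoot] at hβ
    linear_combination hβ
  obtain ⟨y, hy, hy'⟩ := P.solve _ hc β (by rw [hβ']; exact hl)
  refine ⟨y, ?_⟩
  rw [hy]
  field_simp

end AsmPlace


universe u

/-- Generators `X, Y` of a function field with the universal property of the
Artin–Schreier–Mumford function field. -/
structure AsmPair (q : ℕ) {K : Type u} [Field K] (lam : K) {E : Type u} [Field E] [Algebra K E]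
    (X Y : E) : Prop where
  rel : (X ^ q - X) * (Y ^ q - Y) = algebraMap K E lam
  gen : IntermediateField.adjoin K {X, Y} = ⊤
  trX : Transcendental K X
  lift : ∀ (M : Type u) [Field M] [Algebra K M] (x y : M),
    (x ^ q - x) * (y ^ q - y) = algebraMap K M lam → Transcendental K x →
    ∃ φ : E →ₐ[K] M, φ X = x ∧ φ Y = y

theorem asm_trans_of_rel {K E : Type*} [Field K] [Field E] [Algebra K E] {q : ℕ} (hq : 1 < q)
    {lam : K} (hl : lam ≠ 0) {x y : E} (h : (x ^ q - x) * (y ^ q - y) = algebraMap K E lam)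
    (hx : Transcendental K x) : Transcendental K y := by
  intro hy
  apply hx
  have hl' : algebraMap K E lam ≠ 0 := by simpa using hl
  have hc0 : y ^ q - y ≠ 0 := by
    intro h0
    rw [h0, mul_zero] at h
    exact hl' h.symm
  have hc : IsIntegral K (x ^ q - x) := by
    have : x ^ q - x = algebraMap K E lam * (y ^ q - y)⁻¹ := by
      rw [← h]; field_simp
    rw [this]
    have hy' := hy.isIntegral
    exact isIntegral_algebraMap.mul ((hy'.pow q).sub hy').inv
  have hdeg : (Polynomial.X ^ q - Polynomial.X : Polynomial K).natDegree = q := by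
    have := FiniteField.X_pow_card_sub_X_natDegree_eq K hq
    exact this
  have hmon : (Polynomial.X ^ q - Polynomial.X : Polynomial K).Monic :=
    Polynomial.monic_X_pow_sub (by rw [Polynomial.degree_X]; exact_mod_cast hq)
  exact (IsIntegral.of_aeval_monic hmon (by rw [hdeg]; omega) (by simpa using hc)).isAlgebraic

theorem AsmPair.symm {q : ℕ} (hq : 1 < q) {K : Type u} [Field K] {lam : K} (hl : lam ≠ 0)
    {E : Type u} [Field E] [Algebra K E] {X Y : E} (h : AsmPair q lam X Y) : AsmPair q lam Y X where
  rel := by rw [mul_comm]; exact h.rel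
  gen := by rw [Set.pair_comm]; exact h.gen
  trX := asm_trans_of_rel hq hl h.rel h.trX
  lift := by
    intro M _ _ x y hxy hx
    have hyx : (y ^ q - y) * (x ^ q - x) = algebraMap K M lam := by rw [mul_comm]; exact hxy
    obtain ⟨φ, h1, h2⟩ := h.lift M y x hyx (asm_trans_of_rel hq hl hxy hx)
    exact ⟨φ, h2, h1⟩

theorem AsmPair.map {q : ℕ} {K : Type u} [Field K] {lam : K}
    {E E' : Type u} [Field E] [Algebra K E] [Field E'] [Algebra K E'] {X Y : E}
    (h : AsmPair q lam X Y) (e : E ≃ₐ[K] E') : AsmPair q lam (e X) (e Y) where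
  rel := by
    have := congrArg e h.rel
    simpa using this
  gen := by
    have := congrArg (IntermediateField.map e.toAlgHom) h.gen
    rw [IntermediateField.adjoin_map] at this
    rw [Set.image_pair] at this
    refine this.trans ?_
    rw [← AlgHom.fieldRange_eq_map]
    exact AlgEquiv.fieldRange_eq_top e
  trX := by
    intro hx
    exact h.trX ((isAlgebraic_algHom_iff e.toAlgHom e.injective).1 hx)
  lift := by
    intro M _ _ x y hxy hx
    obtain ⟨φ, h1, h2⟩ := h.lift M x y hxy hx
    exact ⟨φ.comp e.symm.toAlgHom, by simp [h1], by simp [h2]⟩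

/-- Ring homomorphisms out of the coordinate ring. -/
theorem asm_ring_lift {q : ℕ} {K : Type u} [Field K] (lam : K) (M : Type u) [Field M] [Algebra K M]
    (x y : M) (h : (x ^ q - x) * (y ^ q - y) = algebraMap K M lam) :
    ∃ φ : asmRing K q lam →ₐ[K] M, φ (Ideal.Quotient.mk _ (MvPolynomial.X 0)) = x ∧
      φ (Ideal.Quotient.mk _ (MvPolynomial.X 1)) = y := by
  refine ⟨Ideal.Quotient.liftₐ _ (MvPolynomial.aeval ![x, y]) ?_, ?_, ?_⟩
  · intro a ha
    rw [Ideal.mem_span_singleton] at ha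
    obtain ⟨b, rfl⟩ := ha
    rw [map_mul]
    have : MvPolynomial.aeval ![x, y] (asmPoly K q lam) = 0 := by
      simp [asmPoly, h]
    rw [this, zero_mul]
  · exact (Ideal.Quotient.lift_mk _ _ _).trans (by simp)
  · exact (Ideal.Quotient.lift_mk _ _ _).trans (by simp)

theorem asm_base {p m q : ℕ} (hp : p.Prime) (hm : 0 < m) (hq : q = p ^ m)
    {K : Type u} [Field K] [CharP K p] (lam : K) (hl : lam ≠ 0) [IsDomain (asmRing K q lam)] :
    AsmPair q lam
      (algebraMap (asmRing K q lam) (FractionRing (asmRing K q lam))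
        (Ideal.Quotient.mk _ (MvPolynomial.X 0)))
      (algebraMap (asmRing K q lam) (FractionRing (asmRing K q lam))
        (Ideal.Quotient.mk _ (MvPolynomial.X 1))) := by
  have hq1 : 1 < q := by rw [hq]; exact Nat.one_lt_pow hm.ne' hp.one_lt
  set R := asmRing K q lam with hR
  set E := FractionRing R with hE
  set x : R := Ideal.Quotient.mk _ (MvPolynomial.X 0) with hx
  set y : R := Ideal.Quotient.mk _ (MvPolynomial.X 1) with hy
  have hrel : (x ^ q - x) * (y ^ q - y) = algebraMap K R lam := by
    have h0 : (Ideal.Quotient.mk (Ideal.span {asmPoly K q lam})) (asmPoly K q lam) = 0 :=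
      Ideal.Quotient.eq_zero_iff_mem.2 (Ideal.mem_span_singleton_self _)
    unfold asmPoly at h0
    rw [map_sub, map_mul, map_sub, map_sub, map_pow, map_pow, sub_eq_zero] at h0
    exact h0
  have hind : ∀ (S : Subalgebra K R), x ∈ S → y ∈ S → ∀ r, r ∈ S := by
    intro S hxS hyS r
    obtain ⟨f, rfl⟩ := Ideal.Quotient.mk_surjective r
    induction f using MvPolynomial.induction_on with
    | C a => exact S.algebraMap_mem a
    | add f g hf hg => rw [map_add]; exact S.add_mem hf hg
    | mul_X f n hf =>
      rw [map_mul]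
      apply S.mul_mem hf
      fin_cases n
      · exact hxS
      · exact hyS
  have hxR : Transcendental K x := by
    have : CharP (AlgebraicClosure K) p := charP_of_injective_algebraMap (algebraMap K _).injective p
    obtain ⟨P⟩ := asm_exists_place (AlgebraicClosure K) (FractionRing (PowerSeries (AlgebraicClosure K)))
      p m q hp hm hq
    obtain ⟨y0, hy0, -⟩ := P.exists_inf hq1 (algebraMap K _ lam) 0 (by simp; omega)
    rw [← IsScalarTower.algebraMap_apply] at hy0
    obtain ⟨φ, h1, h2⟩ := asm_ring_lift lam _ _ _ hy0
    intro halg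
    have h3 : IsAlgebraic K (φ x) := halg.algHom φ
    rw [h1] at h3
    have h4 := h3.inv
    rw [inv_inv] at h4
    exact P.transcendental_of_lt P.t_ne P.t_lt (h4.tower_top _)
  refine ⟨?_, ?_, ?_, ?_⟩
  · have := congrArg (algebraMap R E) hrel
    rw [← IsScalarTower.algebraMap_apply] at this
    simpa using this
  · rw [eq_top_iff]
    intro z _
    have hmem : ∀ r : R, algebraMap R E r ∈ IntermediateField.adjoin K {algebraMap R E x, algebraMap R E y} := by
      apply hind ((IntermediateField.adjoin K {algebraMap R E x, algebraMap R E y}).toSubalgebra.comap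
        (IsScalarTower.toAlgHom K R E))
      · exact IntermediateField.subset_adjoin _ _ (by simp)
      · exact IntermediateField.subset_adjoin _ _ (by simp)
    obtain ⟨a, b, -, rfl⟩ := IsFractionRing.div_surjective (A := R) z
    exact div_mem (hmem a) (hmem b)
  · intro h
    exact hxR ((isAlgebraic_algebraMap_iff (IsFractionRing.injective R E)).1 h)
  · intro M _ _ x0 y0 h0 ht
    obtain ⟨φ, h1, h2⟩ := asm_ring_lift lam M x0 y0 h0
    have hinj : Function.Injective φ := by
      let : Algebra (Polynomial K) R := (Polynomial.aeval (R := K) x).toAlgebra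
      have hAX : ∀ f : Polynomial K, algebraMap (Polynomial K) R f = Polynomial.aeval x f := fun f => rfl
      have : IsScalarTower K (Polynomial K) R := IsScalarTower.of_algebraMap_eq (by
        intro k
        rw [hAX, Polynomial.algebraMap_eq, Polynomial.aeval_C])
      have : FaithfulSMul (Polynomial K) R := by
        rw [faithfulSMul_iff_algebraMap_injective]
        exact transcendental_iff_injective.1 hxR
      have halg : ∀ r : R, IsAlgebraic (Polynomial K) r := by
        apply hind ((Subalgebra.algebraicClosure (Polynomial K) R).restrictScalars K)
        · have : IsAlgebraic (Polynomial K) (algebraMap (Polynomial K) R Polynomial.X) :=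
            isAlgebraic_algebraMap _
          rw [hAX, Polynomial.aeval_X] at this
          exact this
        · refine ⟨Polynomial.C (Polynomial.X ^ q - Polynomial.X) * (Polynomial.X ^ q - Polynomial.X)
            - Polynomial.C (Polynomial.C lam), ?_, ?_⟩
          · intro h
            have := congrArg (fun f => Polynomial.coeff (Polynomial.coeff f 0) 0) h
            have hq0 : q ≠ 0 := by omega
            have hq0' : ¬ (0 = q) := by omega
            simp only [Polynomial.coeff_sub, Polynomial.coeff_C_mul, Polynomial.coeff_X_pow, Polynomial.coeff_X_zero, if_neg hq0', Polynomial.coeff_C_zero, sub_zero, mul_zero, zero_sub, Polynomial.coeff_zero] at this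
            rw [Polynomial.coeff_neg, Polynomial.coeff_C_zero] at this
            exact hl (neg_eq_zero.1 this)
          · simp only [map_sub, map_mul, map_pow, Polynomial.aeval_C, Polynomial.aeval_X, hAX]
            rw [hrel, sub_self]
      rw [injective_iff_map_eq_zero]
      intro r hr
      by_contra hr0
      obtain ⟨f, hf0, g, hfg⟩ := (halg r).exists_nonzero_dvd (mem_nonZeroDivisors_of_ne_zero hr0)
      have h3 := congrArg φ hfg
      rw [map_mul, hr, zero_mul, hAX, ← Polynomial.aeval_algHom_apply, h1] at h3
      exact hf0 (transcendental_iff.1 ht f h3)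
    refine ⟨IsFractionRing.liftAlgHom hinj, ?_, ?_⟩
    · exact (IsFractionRing.lift_algebraMap hinj x).trans h1
    · exact (IsFractionRing.lift_algebraMap hinj y).trans h2


namespace AsmPlace

section Holo
variable {q : ℕ} {L M : Type*} [Field L] [Field M] [Algebra L M] (P : AsmPlace q L M)

theorem δ_pow (hq0 : (q : M) = 0) (z : M) : P.δ (z ^ q) = 0 := by
  rw [Derivation.leibniz_pow, ← Nat.cast_smul_eq_nsmul M, hq0, zero_smul]

theorem δ_sub (hq0 : (q : M) = 0) (z : M) : P.δ (z ^ q - z) = - P.δ z := by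
  rw [map_sub, P.δ_pow hq0, zero_sub]

theorem δ_rel (hq0 : (q : M) = 0) {lam : L} {x y : M}
    (h : (x ^ q - x) * (y ^ q - y) = algebraMap L M lam) :
    (x ^ q - x) * P.δ y = - ((y ^ q - y) * P.δ x) := by
  have h1 := congrArg P.δ h
  rw [Derivation.map_algebraMap, Derivation.leibniz, P.δ_sub hq0, P.δ_sub hq0, smul_eq_mul,
    smul_eq_mul] at h1
  linear_combination -h1

theorem v_as (hq1 : 1 < q) {x : M} (hx : 1 < P.v x) : P.v (x ^ q - x) = P.v x ^ q := by
  have h : P.v x < P.v (x ^ q) := by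
    rw [map_pow]
    exact lt_self_pow₀ hx hq1
  rw [P.v.map_sub_eq_of_lt_left h, map_pow]

theorem v_other (hq1 : 1 < q) {lam : L} {x y : M}
    (h : (x ^ q - x) * (y ^ q - y) = algebraMap L M lam) (hx : 1 < P.v x) : P.v y ≤ 1 := by
  by_contra hy
  rw [not_le] at hy
  have h1 := P.const lam
  rw [← h, map_mul, P.v_as hq1 hx, P.v_as hq1 hy] at h1
  have h2 : 1 < P.v x ^ q := one_lt_pow₀ hx (by omega)
  have h3 : 1 < P.v y ^ q := one_lt_pow₀ hy (by omega)
  exact absurd h1 (not_le.2 (one_lt_mul_of_lt_of_le h2 h3.le))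

theorem holo_inf (hq1 : 1 < q) {x y : M} (hx : 1 < P.v x) (hy : P.v y ≤ 1)
    {i j : ℕ} (hi : i + 2 ≤ q) :
    P.v (x ^ i * y ^ j * (P.δ x / (x ^ q - x))) ≤ 1 := by
  have hx0 : x ≠ 0 := by
    rintro rfl
    simp at hx
  have hs : P.v x⁻¹ ≤ 1 := by
    rw [map_inv₀]
    exact inv_le_one_of_one_le₀ hx.le
  have hδ : P.δ x = - (x ^ 2 * P.δ x⁻¹) := by
    rw [Derivation.leibniz_inv]
    simp only [smul_eq_mul]
    field_simp
  have h1 := P.δO _ hs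
  rw [hδ, map_mul, map_mul, map_div₀, P.v_as hq1 hx, Valuation.map_neg, map_mul, map_pow, map_pow,
    map_pow]
  have h2 : P.v y ^ j ≤ 1 := pow_le_one₀ zero_le hy
  have h3 : P.v x ≠ 0 := by simpa using hx0
  have h4 : P.v x ^ i * P.v x ^ 2 ≤ P.v x ^ q := by
    rw [← pow_add]
    exact pow_le_pow_right₀ hx.le hi
  calc P.v x ^ i * P.v y ^ j * (P.v x ^ 2 * P.v (P.δ x⁻¹) / P.v x ^ q)
      = (P.v x ^ i * P.v x ^ 2 / P.v x ^ q) * (P.v y ^ j * P.v (P.δ x⁻¹)) := by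
        field_simp
    _ ≤ 1 * (1 * 1) := by
        gcongr
        exact div_le_one_of_le₀ h4 zero_le
    _ = 1 := by simp

/-- The differentials `x^i y^j dx / (x^q - x)` are holomorphic. -/
theorem holo (hq0 : (q : M) = 0) (hq1 : 1 < q) {lam : L} (hl : lam ≠ 0) {x y : M}
    (h : (x ^ q - x) * (y ^ q - y) = algebraMap L M lam) {i j : ℕ} (hi : i + 2 ≤ q)
    (hj : j + 2 ≤ q) :
    P.v (x ^ i * y ^ j * (P.δ x / (x ^ q - x))) ≤ 1 := by
  have hl1 := P.v_const hl
  have hl0 : algebraMap L M lam ≠ 0 := by simpa using hl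
  have hu0 : x ^ q - x ≠ 0 := by
    intro h0
    rw [h0, zero_mul] at h
    exact hl0 h.symm
  have hv0 : y ^ q - y ≠ 0 := by
    intro h0
    rw [h0, mul_zero] at h
    exact hl0 h.symm
  by_cases hx : 1 < P.v x
  · exact P.holo_inf hq1 hx (P.v_other hq1 h hx) hi
  by_cases hy : 1 < P.v y
  · have h' : (y ^ q - y) * (x ^ q - x) = algebraMap L M lam := by rw [mul_comm]; exact h
    have h1 := P.holo_inf (x := y) (y := x) (i := j) (j := i) hq1 hy (P.v_other hq1 h' hy) hj
    have h2 := P.δ_rel hq0 h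
    have h3 : x ^ i * y ^ j * (P.δ x / (x ^ q - x)) = - (y ^ j * x ^ i * (P.δ y / (y ^ q - y))) := by
      field_simp
      linear_combination (x ^ i * y ^ j) * h2
    rw [h3, Valuation.map_neg]
    exact h1
  rw [not_lt] at hx hy
  have hu : P.v (x ^ q - x) ≤ 1 := (P.v.map_sub _ _).trans
    (max_le (by rw [map_pow]; exact pow_le_one₀ zero_le hx) hx)
  have hv : P.v (y ^ q - y) ≤ 1 := (P.v.map_sub _ _).trans
    (max_le (by rw [map_pow]; exact pow_le_one₀ zero_le hy) hy)
  have hu1 : P.v (x ^ q - x) = 1 := by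
    apply le_antisymm hu
    by_contra hlt
    rw [not_le] at hlt
    have := asm_mul_lt hv hlt
    rw [mul_comm, ← map_mul, h, hl1] at this
    exact lt_irrefl _ this
  rw [map_mul, map_mul, map_div₀, hu1, div_one, map_pow, map_pow]
  exact mul_le_one₀ (mul_le_one₀ (pow_le_one₀ zero_le hx) zero_le (pow_le_one₀ zero_le hy))
    zero_le (P.δO _ hx)

end Holo

section Der
variable {q : ℕ} {K L M : Type u} [Field K] [Field L] [Field M] [Algebra K L] [Algebra L M]
  [Algebra K M] [IsScalarTower K L M] (P : AsmPlace q L M)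

theorem δ_alg (k : K) : P.δ (algebraMap K M k) = 0 := by
  rw [IsScalarTower.algebraMap_apply K L M, Derivation.map_algebraMap]

theorem rel_map {E : Type u} [Field E] [Algebra K E] {lam : K} {X Y : E}
    (h : AsmPair q lam X Y) (φ : E →ₐ[K] M) :
    ((φ X) ^ q - φ X) * ((φ Y) ^ q - φ Y) = algebraMap L M (algebraMap K L lam) := by
  have := congrArg φ h.rel
  rw [← IsScalarTower.algebraMap_apply K L M]
  simpa using this

theorem exists_der (hq0 : (q : M) = 0) {E : Type u} [Field E] [Algebra K E]
    {lam : K} (hl : lam ≠ 0) {X Y : E} (h : AsmPair q lam X Y) (z : E) :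
    ∃ d : E, ∀ φ : E →ₐ[K] M, P.δ (φ z) = φ d * P.δ (φ X) := by
  have hz : z ∈ IntermediateField.adjoin K {X, Y} := by rw [h.gen]; trivial
  have hl0 : algebraMap K E lam ≠ 0 := by simpa using hl
  have hu0 : X ^ q - X ≠ 0 := by
    intro h0
    have h1 := h.rel
    rw [h0, zero_mul] at h1
    exact hl0 h1.symm
  induction hz using IntermediateField.adjoin_induction with
  | mem z hz =>
    rcases hz with rfl | hz
    · exact ⟨1, fun φ => by simp⟩
    · rw [Set.mem_singleton_iff] at hz
      subst hz
      refine ⟨-((z ^ q - z) / (X ^ q - X)), fun φ => ?_⟩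
      have h2 := P.δ_rel hq0 (rel_map (L := L) h φ)
      have h3 : φ X ^ q - φ X ≠ 0 := by
        intro h0
        apply hu0
        apply φ.injective
        simpa using h0
      simp only [map_neg, map_div₀, map_sub, map_pow]
      field_simp
      rw [mul_comm]
      exact h2
  | algebraMap k => exact ⟨0, fun φ => by rw [AlgHom.commutes, P.δ_alg]; simp⟩
  | add a b _ _ ha hb =>
    obtain ⟨d1, h1⟩ := ha
    obtain ⟨d2, h2⟩ := hb
    exact ⟨d1 + d2, fun φ => by rw [map_add, map_add, h1, h2, map_add, add_mul]⟩
  | inv a _ ha =>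
    obtain ⟨d1, h1⟩ := ha
    refine ⟨-a⁻¹ ^ 2 * d1, fun φ => ?_⟩
    rw [map_inv₀, Derivation.leibniz_inv, h1]
    simp only [smul_eq_mul, map_mul, map_neg, map_pow, map_inv₀]
    ring
  | mul a b _ _ ha hb =>
    obtain ⟨d1, h1⟩ := ha
    obtain ⟨d2, h2⟩ := hb
    refine ⟨a * d2 + b * d1, fun φ => ?_⟩
    rw [map_mul, Derivation.leibniz, h1, h2]
    simp only [smul_eq_mul, map_mul, map_add]
    ring

end Der

end AsmPlace


section AsmAlg
open IntermediateField

theorem asm_ratfun {K E : Type*} [Field K] [Field E] [Algebra K E] {X x : E} 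
    (hx : x ∈ K⟮X⟯) : ∃ N D : Polynomial K, IsCoprime N D ∧ D ≠ 0 ∧
      x * Polynomial.aeval X D = Polynomial.aeval X N := by
  classical
  rw [mem_adjoin_simple_iff] at hx
  obtain ⟨r, s, rfl⟩ := hx
  by_cases hs : Polynomial.aeval X s = 0
  · refine ⟨0, 1, isCoprime_one_right, one_ne_zero, ?_⟩
    simp [hs]
  have hs0 : s ≠ 0 := by
    rintro rfl
    simp at hs
  obtain ⟨a, ha⟩ := EuclideanDomain.gcd_dvd_left r s
  obtain ⟨b, hb⟩ := EuclideanDomain.gcd_dvd_right r s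
  have hg := EuclideanDomain.gcd_eq_gcd_ab r s
  set g := EuclideanDomain.gcd r s with hgdef
  have hg0 : g ≠ 0 := by
    intro h
    rw [h, zero_mul] at hb
    exact hs0 hb
  refine ⟨a, b, ⟨EuclideanDomain.gcdA r s, EuclideanDomain.gcdB r s, ?_⟩, ?_, ?_⟩
  · apply mul_left_cancel₀ hg0
    calc g * (EuclideanDomain.gcdA r s * a + EuclideanDomain.gcdB r s * b)
        = (g * a) * EuclideanDomain.gcdA r s + (g * b) * EuclideanDomain.gcdB r s := by ring
      _ = g * 1 := by rw [← ha, ← hb, mul_one]; exact hg.symm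
  · rintro rfl
    rw [mul_zero] at hb
    exact hs0 hb
  · have h1 := congrArg (Polynomial.aeval X) ha
    have h2 := congrArg (Polynomial.aeval X) hb
    rw [map_mul] at h1 h2
    rw [div_mul_eq_mul_div, div_eq_iff hs, h1, h2]
    ring

variable {q : ℕ} {K E : Type u} [Field K] [Field E] [Algebra K E]

theorem AsmPair.u_ne {lam : K} (hl : lam ≠ 0) {X Y : E} (h : AsmPair q lam X Y) :
    X ^ q - X ≠ 0 := by
  intro h0
  have h1 := h.rel
  rw [h0, zero_mul] at h1
  exact hl (by simpa using h1.symm)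

theorem AsmPair.v_ne {lam : K} (hl : lam ≠ 0) {X Y : E} (h : AsmPair q lam X Y) :
    Y ^ q - Y ≠ 0 := by
  intro h0
  have h1 := h.rel
  rw [h0, mul_zero] at h1
  exact hl (by simpa using h1.symm)

theorem asm_add_const {p m : ℕ} (hp : p.Prime) (hq : q = p ^ m) [CharP K p]
    {F : Type*} [Field F] [Fintype F] (hF : Fintype.card F = q) (i : F →+* K) (Y : E) (a : F) :
    (Y + algebraMap K E (i a)) ^ q - (Y + algebraMap K E (i a)) = Y ^ q - Y := by
  have : Fact p.Prime := ⟨hp⟩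
  have : CharP E p := charP_of_injective_algebraMap (algebraMap K E).injective p
  have ha : a ^ q = a := by rw [← hF]; exact FiniteField.pow_card a
  have h1 : (Y + algebraMap K E (i a)) ^ q = Y ^ q + algebraMap K E (i a) := by
    rw [hq, add_pow_char_pow, ← hq, ← map_pow, ← map_pow, ha]
  rw [h1]
  ring

theorem AsmPair.autos {p m : ℕ} (hp : p.Prime) (hq : q = p ^ m) [CharP K p]
    {F : Type*} [Field F] [Fintype F] (hF : Fintype.card F = q) (i : F →+* K)
    {lam : K} {X Y : E} (h : AsmPair q lam X Y) :
    ∃ σ : F → (E →ₐ[K] E), ∀ a, σ a X = X ∧ σ a Y = Y + algebraMap K E (i a) := by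
  have : ∀ a : F, ∃ σ : E →ₐ[K] E, σ X = X ∧ σ Y = Y + algebraMap K E (i a) := by
    intro a
    apply h.lift E X _ _ h.trX
    rw [asm_add_const hp hq hF i]
    exact h.rel
  choose σ hσ using this
  exact ⟨σ, hσ⟩

theorem asm_fix {X : E} (σ : E →ₐ[K] E) (hσ : σ X = X) {z : E} (hz : z ∈ K⟮X⟯) : σ z = z := by
  rw [mem_adjoin_simple_iff] at hz
  obtain ⟨r, s, rfl⟩ := hz
  rw [map_div₀, ← Polynomial.aeval_algHom_apply, ← Polynomial.aeval_algHom_apply, hσ]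

theorem AsmPair.expand (hq1 : 1 < q) {lam : K} (hl : lam ≠ 0) {X Y : E} (h : AsmPair q lam X Y)
    (f : E) : ∃ a : ℕ → E, (∀ k, a k ∈ K⟮X⟯) ∧ f = ∑ k ∈ Finset.range q, a k * Y ^ k := by
  have hu := h.u_ne hl
  let XX : K⟮X⟯ := ⟨X, mem_adjoin_simple_self K X⟩
  let c : K⟮X⟯ := algebraMap K K⟮X⟯ lam / (XX ^ q - XX)
  let g0 : Polynomial K⟮X⟯ := Polynomial.X ^ q - (Polynomial.X + Polynomial.C c)
  have hdX : (Polynomial.X + Polynomial.C c).degree < (q : WithBot ℕ) := by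
    rw [Polynomial.degree_X_add_C]; exact_mod_cast hq1
  have hmon : g0.Monic := Polynomial.monic_X_pow_sub hdX
  have hdeg : g0.natDegree = q := by
    have := Polynomial.natDegree_sub_eq_left_of_natDegree_lt (p := (Polynomial.X ^ q : Polynomial K⟮X⟯))
      (q := Polynomial.X + Polynomial.C c) (by
        rw [Polynomial.natDegree_X_add_C, Polynomial.natDegree_X_pow]; exact hq1)
    rw [Polynomial.natDegree_X_pow] at this
    exact this
  have hroot : Polynomial.aeval Y g0 = 0 := by
    have hc : algebraMap K⟮X⟯ E c = Y ^ q - Y := by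
      have : algebraMap K⟮X⟯ E c = algebraMap K E lam / (X ^ q - X) := by
        simp only [c, map_div₀, map_sub, map_pow]
        rfl
      rw [this, ← h.rel]
      field_simp
    simp only [g0, map_sub, map_add, map_pow, Polynomial.aeval_X, Polynomial.aeval_C, hc]
    ring
  have hInteg : IsIntegral K⟮X⟯ Y := ⟨g0, hmon, hroot⟩
  have hf : f ∈ (K⟮X⟯⟮Y⟯).toSubalgebra := by
    have h1 : f ∈ (K⟮X⟯⟮Y⟯).restrictScalars K := by
      have h2 := adjoin_adjoin_left K {X} ({Y} : Set E)
      rw [h2, Set.singleton_union, h.gen]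
      trivial
    exact h1
  rw [adjoin_simple_toSubalgebra_of_isAlgebraic hInteg.isAlgebraic,
    Algebra.adjoin_singleton_eq_range_aeval] at hf
  obtain ⟨g, rfl⟩ := hf
  refine ⟨fun k => ((g %ₘ g0).coeff k : E), fun k => SetLike.coe_mem _, ?_⟩
  have h3 : Polynomial.aeval Y g = Polynomial.aeval Y (g %ₘ g0) :=
    (Polynomial.aeval_modByMonic_eq_self_of_root hroot).symm
  have h4 : (g %ₘ g0).natDegree < q := by
    rw [← hdeg]
    apply Polynomial.natDegree_modByMonic_lt _ hmon
    intro h5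
    rw [h5] at hdeg
    simp at hdeg
    omega
  change Polynomial.aeval Y g = _
  rw [h3, Polynomial.aeval_eq_sum_range' h4]
  rfl

/-- The trace of an expansion is a multiple of the top coefficient. -/
theorem asm_trace {F : Type*} [Field F] [Fintype F] (hF : Fintype.card F = q) (hq1 : 1 < q)
    (i : F →+* K) {X Y : E} (σ : F → (E →ₐ[K] E))
    (hσ : ∀ a, σ a X = X ∧ σ a Y = Y + algebraMap K E (i a)) (a : ℕ → E) (ha : ∀ k, a k ∈ K⟮X⟯) :
    ∃ s : K, ∑ b, σ b (∑ k ∈ Finset.range q, a k * Y ^ k) = algebraMap K E s * a (q - 1) := by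
  have hpow : ∀ j < q - 1, ∑ b : F, algebraMap K E (i b) ^ j = 0 := by
    intro j hj
    have := FiniteField.sum_pow_lt_card_sub_one F j (by rw [hF]; exact hj)
    have h2 := congrArg ((algebraMap K E).comp i) this
    simpa using h2
  have hk : ∀ k < q - 1, ∑ b : F, (Y + algebraMap K E (i b)) ^ k = 0 := by
    intro k hk
    simp_rw [add_pow]
    rw [Finset.sum_comm]
    apply Finset.sum_eq_zero
    intro j hj
    rw [Finset.mem_range] at hj
    rw [← Finset.sum_mul, ← Finset.mul_sum, hpow (k - j) (by omega)]
    simp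
  have hk1 : ∑ b : F, (Y + algebraMap K E (i b)) ^ (q - 1) =
      algebraMap K E (∑ b : F, (i b) ^ (q - 1)) := by
    simp_rw [add_pow]
    rw [Finset.sum_comm, Finset.sum_range_succ']
    rw [Finset.sum_eq_zero]
    · simp
    · intro j hj
      rw [Finset.mem_range] at hj
      rw [← Finset.sum_mul, ← Finset.mul_sum, hpow (q - 1 - (j + 1)) (by omega)]
      simp
  refine ⟨∑ b : F, (i b) ^ (q - 1), ?_⟩
  have h1 : ∀ b, σ b (∑ k ∈ Finset.range q, a k * Y ^ k) =
      ∑ k ∈ Finset.range q, a k * (Y + algebraMap K E (i b)) ^ k := by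
    intro b
    rw [map_sum]
    apply Finset.sum_congr rfl
    intro k _
    rw [map_mul, map_pow, (hσ b).2, asm_fix (σ b) (hσ b).1 (ha k)]
  simp_rw [h1]
  rw [Finset.sum_comm]
  simp_rw [← Finset.mul_sum]
  obtain ⟨r, rfl⟩ : ∃ r, q = r + 1 := ⟨q - 1, by omega⟩
  rw [Finset.sum_range_succ, Finset.sum_eq_zero, zero_add]
  · rw [Nat.add_sub_cancel] at hk1 ⊢
    rw [hk1, mul_comm]
  · intro k hk'
    rw [Finset.mem_range] at hk'
    rw [hk k (by omega), mul_zero]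

theorem AsmPair.mem_of_fixed (hq1 : 1 < q) {F : Type*} [Field F] [Fintype F]
    (hF : Fintype.card F = q) (i : F →+* K) {lam : K} (hl : lam ≠ 0) {X Y : E}
    (h : AsmPair q lam X Y) (σ : F → (E →ₐ[K] E))
    (hσ : ∀ a, σ a X = X ∧ σ a Y = Y + algebraMap K E (i a)) {z : E} (hz : ∀ a, σ a z = z) :
    z ∈ K⟮X⟯ := by
  obtain ⟨a, ha, hza⟩ := h.expand hq1 hl z
  let G : Polynomial E := (∑ k ∈ Finset.range q, Polynomial.C (a k) * Polynomial.X ^ k)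
    - Polynomial.C z
  have hG : G = 0 := by
    apply Polynomial.eq_zero_of_natDegree_lt_card_of_eval_eq_zero (ι := F)
      (f := fun b => Y + algebraMap K E (i b)) G
    · intro b c hbc
      exact i.injective ((algebraMap K E).injective (add_left_cancel hbc))
    · intro b
      have h1 : σ b z = ∑ k ∈ Finset.range q, a k * (Y + algebraMap K E (i b)) ^ k := by
        conv_lhs => rw [hza]
        rw [map_sum]
        apply Finset.sum_congr rfl
        intro k _
        rw [map_mul, map_pow, (hσ b).2, asm_fix (σ b) (hσ b).1 (ha k)]
      simp only [G, Polynomial.eval_sub, Polynomial.eval_finsetSum, Polynomial.eval_mul,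
        Polynomial.eval_C, Polynomial.eval_pow, Polynomial.eval_X]
      rw [← h1, hz, sub_self]
    · rw [hF]
      have h2 : G.natDegree ≤ q - 1 := by
        apply (Polynomial.natDegree_sub_le _ _).trans
        rw [Polynomial.natDegree_C, max_eq_left (Nat.zero_le _)]
        apply Polynomial.natDegree_sum_le_of_forall_le
        intro k hk
        rw [Finset.mem_range] at hk
        exact (Polynomial.natDegree_C_mul_X_pow_le _ _).trans (by omega)
      omega
  have h3 := congrArg (fun g => Polynomial.coeff g 0) hG
  simp only [G, Polynomial.coeff_sub, Polynomial.finsetSum_coeff, Polynomial.coeff_C_mul,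
    Polynomial.coeff_X_pow, Polynomial.coeff_C_zero, Polynomial.coeff_zero] at h3
  rw [Finset.sum_eq_single 0] at h3
  · simp only [if_true, mul_one, sub_eq_zero] at h3
    rw [← h3]
    exact ha 0
  · intro b _ hb
    rw [if_neg (Ne.symm hb), mul_zero]
  · intro h0
    exact absurd (Finset.mem_range.2 (by omega)) h0

end AsmAlg


namespace AsmPlace
open IntermediateField

section Vals
variable {q : ℕ} {K L M : Type u} [Field K] [Field L] [Field M] [Algebra K L] [Algebra L M]
  [Algebra K M] [IsScalarTower K L M] (P : AsmPlace q L M)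

theorem v_poly {z : M} {α : L} (h : P.v (z - algebraMap L M α) < 1) {g : Polynomial K}
    (hg : g ≠ 0) : ∃ n : ℕ, P.v (Polynomial.aeval z g) = P.v (z - algebraMap L M α) ^ n := by
  have hg' : g.map (algebraMap K L) ≠ 0 := by
    rwa [Polynomial.map_ne_zero_iff (algebraMap K L).injective]
  obtain ⟨r, hr, hnd⟩ := Polynomial.exists_eq_pow_rootMultiplicity_mul_and_not_dvd _ hg' α
  refine ⟨Polynomial.rootMultiplicity α (g.map (algebraMap K L)), ?_⟩
  rw [← Polynomial.aeval_map_algebraMap L z g]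
  conv_lhs => rw [hr]
  rw [map_mul, map_mul, map_pow, map_pow, P.v_aeval_eq_one h r, mul_one]
  · simp
  · intro h0
    exact hnd (Polynomial.dvd_iff_isRoot.2 h0)

theorem v_rat {E : Type u} [Field E] [Algebra K E] {X w : E} (hX : Transcendental K X)
    (hw : w ∈ K⟮X⟯) (hw0 : w ≠ 0) (φ : E →ₐ[K] M) {α : L} (h : P.v (φ X - algebraMap L M α) < 1) 
    (h0 : φ X - algebraMap L M α ≠ 0) :
    ∃ n : ℤ, P.v (φ w) = P.v (φ X - algebraMap L M α) ^ n := by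
  obtain ⟨N, D, -, hD, hND⟩ := asm_ratfun hw
  have hD1 : Polynomial.aeval X D ≠ 0 := fun h1 => hD (transcendental_iff.1 hX D h1)
  have hN : N ≠ 0 := by
    rintro rfl
    rw [map_zero] at hND
    exact mul_ne_zero hw0 hD1 hND
  obtain ⟨n1, h1⟩ := P.v_poly h hN
  obtain ⟨n2, h2⟩ := P.v_poly h hD
  have h3 := congrArg (fun z => P.v (φ z)) hND
  simp only [map_mul] at h3
  rw [← Polynomial.aeval_algHom_apply φ, ← Polynomial.aeval_algHom_apply φ, h1, h2] at h3
  have hv : P.v (φ X - algebraMap L M α) ≠ 0 := by simpa using h0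
  refine ⟨n1 - n2, ?_⟩
  rw [zpow_sub₀ hv, zpow_natCast, zpow_natCast, eq_div_iff (pow_ne_zero _ hv)]
  exact h3

theorem v_sum_distinct {ι : Type*} (s : Finset ι) (f : ι → M)
    (h : ∀ a ∈ s, ∀ b ∈ s, f a ≠ 0 → P.v (f a) = P.v (f b) → a = b) :
    ∀ a ∈ s, P.v (f a) ≤ P.v (∑ k ∈ s, f k) := by
  classical
  intro a ha
  obtain ⟨b, hb, hmax⟩ := Finset.exists_max_image s (fun k => P.v (f k)) ⟨a, ha⟩
  by_cases hb0 : f b = 0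
  · have := hmax a ha
    rw [hb0, map_zero] at this
    exact this.trans zero_le
  have hvb : P.v (f b) ≠ 0 := by simpa using hb0
  rw [← Finset.add_sum_erase s f hb, P.v.map_add_eq_of_lt_left]
  · exact hmax a ha
  · apply P.v.map_sum_lt hvb
    intro k hk
    rw [Finset.mem_erase] at hk
    apply lt_of_le_of_ne (hmax k hk.2)
    intro heq
    exact hk.1 (h b hb k hk.2 hb0 heq.symm).symm

theorem δ_inv_t : P.δ (P.t⁻¹) = - (P.t⁻¹ ^ 2) := by
  rw [Derivation.leibniz_inv, P.δt]
  simp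

theorem v_poly_inf {g : Polynomial K} (hg : g ≠ 0) : 1 ≤ P.v (Polynomial.aeval P.t⁻¹ g) := by
  have ht := P.t_ne
  have ht0 : P.v P.t ≠ 0 := by simpa using ht
  let _ : Invertible P.t⁻¹ := invertibleOfNonzero (inv_ne_zero ht)
  set g' := g.map (algebraMap K L) with hg'def
  have hg' : g' ≠ 0 := by
    rwa [hg'def, Polynomial.map_ne_zero_iff (algebraMap K L).injective]
  have h1 := Polynomial.eval₂_reverse_mul_pow (algebraMap L M) P.t⁻¹ g'
  rw [invOf_eq_inv, inv_inv, ← Polynomial.aeval_def, ← Polynomial.aeval_def,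
    Polynomial.aeval_map_algebraMap L] at h1
  rw [← h1, map_mul, P.v_aeval_eq_one (α := 0) (by simpa using P.t_lt), one_mul, map_pow, map_inv₀]
  · apply one_le_pow₀
    exact (one_le_inv₀ (zero_lt_iff.2 ht0)).2 P.t_lt.le
  · rw [← Polynomial.coeff_zero_eq_eval_zero, Polynomial.coeff_zero_reverse]
    simpa using hg'

theorem v_close_root (hq1 : 1 < q) {z : M} {α : L} (hα : α ^ q = α) 
    {p m : ℕ} (hp : p.Prime) (hq : q = p ^ m) [CharP M p]
    (h : P.v (z - algebraMap L M α) < 1) : P.v (z ^ q - z) = P.v (z - algebraMap L M α) := by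
  have : Fact p.Prime := ⟨hp⟩
  set ξ := z - algebraMap L M α with hξ
  have hz : z = ξ + algebraMap L M α := by rw [hξ]; ring
  have h1 : z ^ q - z = ξ ^ q - ξ := by
    have : z ^ q = ξ ^ q + algebraMap L M α := by
      rw [hz, hq, add_pow_char_pow, ← hq, ← map_pow, hα]
    rw [this, hz]; ring
  by_cases h0 : ξ = 0
  · rw [h1, h0, zero_pow (by omega)]; simp
  have h2 : P.v (ξ ^ q) < P.v ξ := by
    rw [map_pow]
    have h3 : P.v ξ ≠ 0 := by simpa using h0
    exact pow_lt_self_of_lt_one₀ (zero_lt_iff.2 h3) h hq1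
  rw [h1, P.v.map_sub_eq_of_lt_right h2]

end Vals
end AsmPlace


namespace AsmPlace
open IntermediateField

section Trace
variable {q : ℕ} {K L M : Type u} [Field K] [Field L] [Field M] [Algebra K L] [Algebra L M]
  [Algebra K M] [IsScalarTower K L M] (P : AsmPlace q L M)
  {E : Type u} [Field E] [Algebra K E]

theorem trans_of_trans {z : M} (hz : Transcendental L z) : Transcendental K z :=
  fun h => hz (h.tower_top L)

/-- A pole estimate at a point where `X` is a root of `T^q - T`. -/
theorem pole_bound (hq1 : 1 < q) {p m : ℕ} (hp : p.Prime) (hq : q = p ^ m) [CharP M p]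
    (hq0 : (q : M) = 0) {lam : K} (hl : lam ≠ 0) {X Y : E} (h : AsmPair q lam X Y)
    (a : ℕ → E) (ha : ∀ k, a k ∈ K⟮X⟯) (φ : E →ₐ[K] M) (hY : φ Y = P.t⁻¹) {α : L} (hα : α ^ q = α)
    (hX : P.v (φ X - algebraMap L M α) < 1)
    (hf : P.v (φ (∑ k ∈ Finset.range q, a k * Y ^ k) * P.δ (φ X)) ≤ 1) :
    P.v (φ (a (q - 1))) ≤ 1 := by
  have hrel := rel_map (L := L) h φ
  have hlam : P.v (algebraMap L M (algebraMap K L lam)) = 1 :=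
    P.v_const (by simpa using hl)
  have ht0 : P.v P.t ≠ 0 := by simpa using P.t_ne
  have htpos : 0 < P.v P.t := zero_lt_iff.2 ht0
  set τ := P.v P.t with hτ
  have hτ1 : τ < 1 := P.t_lt
  have hu : P.v (φ X ^ q - φ X) = τ ^ q := by
    have h1 := congrArg P.v hrel
    rw [map_mul, hlam, hY, P.v_inv_t hq1, ← hτ] at h1
    rwa [mul_inv_eq_one₀ (pow_ne_zero _ ht0)] at h1
  have hcl : P.v (φ X - algebraMap L M α) = τ ^ q := by
    rw [← P.v_close_root hq1 hα hp hq hX, hu]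
  have hXne : φ X - algebraMap L M α ≠ 0 := by
    intro h0
    rw [h0, map_zero] at hcl
    exact pow_ne_zero q ht0 hcl.symm
  have hδ : P.v (P.δ (φ X)) = τ ^ (2 * (q : ℤ) - 2) := by
    have h1 := congrArg P.v (P.δ_rel hq0 hrel)
    rw [hY, map_mul, Valuation.map_neg, map_mul, hu, P.v_inv_t hq1, P.δ_inv_t, Valuation.map_neg,
      map_pow, map_inv₀, ← hτ] at h1
    have h2 : P.v (P.δ (φ X)) = τ ^ q * (τ ^ q * τ⁻¹ ^ 2) := by
      rw [h1]
      field_simp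
    rw [h2, two_mul, zpow_sub₀ ht0, zpow_add₀ ht0, zpow_natCast]
    rw [inv_pow, zpow_ofNat, div_eq_mul_inv, mul_assoc]
  have hval : ∀ k, a k ≠ 0 → ∃ n : ℤ, P.v (φ (a k) * P.t⁻¹ ^ k) = τ ^ ((q : ℤ) * n - k) ∧
      P.v (φ (a k)) = τ ^ ((q : ℤ) * n) := by
    intro k hk
    obtain ⟨n, hn⟩ := P.v_rat h.trX (ha k) hk φ hX hXne
    have h1 : P.v (φ (a k)) = τ ^ ((q : ℤ) * n) := by
      rw [hn, hcl, zpow_mul, zpow_natCast]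
    refine ⟨n, ?_, h1⟩
    rw [map_mul, h1, map_pow, map_inv₀, ← hτ, zpow_sub₀ ht0, zpow_natCast, inv_pow, div_eq_mul_inv]
  have hinj := zpow_right_injective₀ htpos hτ1.ne
  have hdist := P.v_sum_distinct (Finset.range q) (fun k => φ (a k) * P.t⁻¹ ^ k) (by
    intro k hk j hj hk0 hkj
    rw [Finset.mem_range] at hk hj
    have hak : a k ≠ 0 := by
      intro h0
      apply hk0
      simp [h0]
    have haj : a j ≠ 0 := by
      intro h0
      apply hk0
      have : P.v (φ (a k) * P.t⁻¹ ^ k) = 0 := by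
        rw [hkj]; simp [h0]
      simpa using this
    obtain ⟨n1, h1, -⟩ := hval k hak
    obtain ⟨n2, h2, -⟩ := hval j haj
    rw [h1, h2] at hkj
    have h3 := hinj hkj
    have h4 : (k : ℤ) - j = q * (n1 - n2) := by linarith
    have h5 : (k : ℤ) - j = 0 := by
      apply Int.eq_zero_of_abs_lt_dvd (m := q) ⟨_, h4⟩
      rw [abs_lt]
      constructor <;> omega
    omega) (q - 1) (Finset.mem_range.2 (by omega))
  by_cases h0 : a (q - 1) = 0
  · rw [h0]; simp
  obtain ⟨n, h1, h2⟩ := hval (q - 1) h0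
  have hsum : φ (∑ k ∈ Finset.range q, a k * Y ^ k) = ∑ k ∈ Finset.range q, φ (a k) * P.t⁻¹ ^ k := by
    rw [map_sum]
    apply Finset.sum_congr rfl
    intro k _
    rw [map_mul, map_pow, hY]
  rw [hsum, map_mul] at hf
  have h3 : τ ^ ((q : ℤ) * n - (q - 1 : ℕ)) * τ ^ (2 * (q : ℤ) - 2) ≤ 1 := by
    refine le_trans ?_ hf
    rw [hδ, ← h1]
    gcongr
  rw [← zpow_add₀ ht0, zpow_le_one_iff_right_of_lt_one₀ htpos hτ1] at h3
  rw [h2, zpow_le_one_iff_right_of_lt_one₀ htpos hτ1]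
  have hqc : ((q - 1 : ℕ) : ℤ) = q - 1 := by omega
  rw [hqc] at h3
  have hn : 0 ≤ n := by
    by_contra hneg
    have : n ≤ -1 := by omega
    nlinarith
  positivity

theorem trace_zero [IsAlgClosed L] (hq1 : 1 < q) {p m : ℕ} (hp : p.Prime) (hq : q = p ^ m) [CharP M p]
    (hq0 : (q : M) = 0) {lam : K} (hl : lam ≠ 0) {X Y : E} (h : AsmPair q lam X Y)
    {F : Type*} [Field F] [Fintype F] (hF : Fintype.card F = q) (i : F →+* K)
    (σ : F → (E →ₐ[K] E)) (hσ : ∀ a, σ a X = X ∧ σ a Y = Y + algebraMap K E (i a))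
    (f : E) (hf : ∀ φ : E →ₐ[K] M, P.v (φ f * P.δ (φ X)) ≤ 1) :
    ∑ b, σ b f = 0 := by
  obtain ⟨a, ha, hfa⟩ := h.expand hq1 hl f
  obtain ⟨s, hs⟩ := asm_trace hF hq1 i σ hσ a ha
  rw [← hfa] at hs
  set w := ∑ b, σ b f with hwdef
  have hw : w ∈ K⟮X⟯ := by
    rw [hs]
    exact mul_mem (IntermediateField.algebraMap_mem _ s) (ha _)
  have htr : ∀ φ : E →ₐ[K] M, P.v (φ w * P.δ (φ X)) ≤ 1 := by
    intro φ
    rw [hwdef, map_sum, Finset.sum_mul]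
    apply P.v.map_sum_le
    intro b _
    have := hf (φ.comp (σ b))
    rw [AlgHom.comp_apply, AlgHom.comp_apply, (hσ b).1] at this
    exact this
  have hpt : ∀ α : L, ∃ φ : E →ₐ[K] M, P.v (φ X - algebraMap L M α) < 1 ∧ P.v (φ w) ≤ 1 := by
    intro α
    by_cases hα : α ^ q = α
    · obtain ⟨y, hy, hyα⟩ := P.exists_inf hq1 (algebraMap K L lam) α hα
      rw [← IsScalarTower.algebraMap_apply] at hy
      have htt : Transcendental K P.t⁻¹ := by
        apply trans_of_trans (L := L)
        intro halg
        have := halg.inv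
        rw [inv_inv] at this
        exact P.transcendental_of_lt P.t_ne P.t_lt this
      obtain ⟨φ, h1, h2⟩ := (h.symm hq1 hl).lift M _ _ hy htt
      refine ⟨φ, by rw [h2]; exact hyα, ?_⟩
      have h3 := P.pole_bound hq1 hp hq hq0 hl h a ha φ h1 hα (by rw [h2]; exact hyα)
        (by rw [← hfa]; exact hf φ)
      rw [hs, map_mul, AlgHom.commutes, map_mul, IsScalarTower.algebraMap_apply K L M]
      exact mul_le_one₀ (P.const _) zero_le h3
    · obtain ⟨y, hy⟩ := P.exists_fin hq1 (algebraMap K L lam) α hα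
      rw [← IsScalarTower.algebraMap_apply K L M] at hy
      have htt : Transcendental K (algebraMap L M α + P.t) := by
        apply trans_of_trans (L := L)
        intro halg
        have := halg.sub (isAlgebraic_algebraMap (R := L) (A := M) α)
        rw [add_sub_cancel_left] at this
        exact P.transcendental_of_lt P.t_ne P.t_lt this
      obtain ⟨φ, h1, h2⟩ := h.lift M _ _ hy htt
      refine ⟨φ, by rw [h1, add_sub_cancel_left]; exact P.t_lt, ?_⟩
      have h3 := htr φ
      rw [h1, map_add, Derivation.map_algebraMap, P.δt, zero_add, mul_one] at h3
      exact h3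
  obtain ⟨N, D, hcop, hD0, hND⟩ := asm_ratfun hw
  have hDdeg : (D.map (algebraMap K L)).degree = 0 := by
    by_contra hdeg
    obtain ⟨α, hα⟩ := IsAlgClosed.exists_root _ hdeg
    obtain ⟨φ, h1, h2⟩ := hpt α
    have hNα : (N.map (algebraMap K L)).eval α ≠ 0 := by
      intro hN
      obtain ⟨A, B, hAB⟩ := hcop
      have h3 := congrArg (fun g => (g.map (algebraMap K L)).eval α) hAB
      simp only [Polynomial.map_add, Polynomial.map_mul, Polynomial.eval_add, Polynomial.eval_mul,
        Polynomial.map_one, Polynomial.eval_one, hN, mul_zero, zero_add] at h3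
      rw [Polynomial.IsRoot.def] at hα
      rw [hα, mul_zero] at h3
      exact zero_ne_one h3
    have h4 := P.v_aeval_eq_one h1 _ hNα
    have h5 := P.v_aeval_lt_one h1 _ hα
    rw [Polynomial.aeval_map_algebraMap L] at h4 h5
    have h6 := congrArg (fun z => P.v (φ z)) hND
    simp only [map_mul] at h6
    rw [← Polynomial.aeval_algHom_apply φ, ← Polynomial.aeval_algHom_apply φ, h4] at h6
    have h7 := asm_mul_lt h2 h5
    rw [h6] at h7
    exact lt_irrefl _ h7
  rw [Polynomial.degree_map] at hDdeg
  have hDC := Polynomial.eq_C_of_degree_eq_zero hDdeg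
  have hN0 : N = 0 := by
    by_contra hN
    obtain ⟨y, hy, -⟩ := P.exists_inf hq1 (algebraMap K L lam) 0 (by rw [zero_pow]; omega)
    rw [← IsScalarTower.algebraMap_apply] at hy
    have htt : Transcendental K P.t⁻¹ := by
      apply trans_of_trans (L := L)
      intro halg
      have := halg.inv
      rw [inv_inv] at this
      exact P.transcendental_of_lt P.t_ne P.t_lt this
    obtain ⟨φ, h1, h2⟩ := h.lift M _ _ hy htt
    have h3 := htr φ
    have ht0 : P.v P.t ≠ 0 := by simpa using P.t_ne
    rw [h1, map_mul, P.δ_inv_t, Valuation.map_neg, map_pow, map_inv₀] at h3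
    have h4 : P.v (φ w) < 1 := by
      have h5 : P.v (φ w) = P.v (φ w) * (P.v P.t)⁻¹ ^ 2 * P.v P.t ^ 2 := by
        field_simp
      rw [h5]
      apply asm_mul_lt h3
      exact pow_lt_one₀ zero_le P.t_lt two_ne_zero
    have h6 := congrArg (fun z => P.v (φ z)) hND
    simp only [map_mul] at h6
    rw [← Polynomial.aeval_algHom_apply φ, ← Polynomial.aeval_algHom_apply φ, h1] at h6
    have h7 := P.v_poly_inf hN
    rw [← h6, hDC, Polynomial.aeval_C, IsScalarTower.algebraMap_apply K L M, mul_comm] at h7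
    exact absurd (asm_mul_lt (P.const _) h4) (not_lt.2 h7)
  rw [hN0, map_zero] at hND
  rcases mul_eq_zero.1 hND with h1 | h1
  · exact h1
  · exact absurd (transcendental_iff.1 h.trX D h1) hD0

end Trace
end AsmPlace


section AsmCore
open IntermediateField

variable {q : ℕ} {K E : Type u} [Field K] [Field E] [Algebra K E]

theorem AsmPair.hom_ext {lam : K} {X Y : E} (h : AsmPair q lam X Y) {M : Type*} [Field M]
    [Algebra K M] {φ ψ : E →ₐ[K] M} (hX : φ X = ψ X) (hY : φ Y = ψ Y) (z : E) : φ z = ψ z := by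
  have hz : z ∈ IntermediateField.adjoin K {X, Y} := by rw [h.gen]; trivial
  induction hz using IntermediateField.adjoin_induction with
  | mem z hz =>
    rcases hz with rfl | hz
    · exact hX
    · rw [Set.mem_singleton_iff] at hz
      rw [hz]; exact hY
  | algebraMap k => rw [AlgHom.commutes, AlgHom.commutes]
  | add a b _ _ ha hb => rw [map_add, map_add, ha, hb]
  | inv a _ ha => rw [map_inv₀, map_inv₀, ha]
  | mul a b _ _ ha hb => rw [map_mul, map_mul, ha, hb]

theorem asm_exists_forms {p m : ℕ} (hp : p.Prime) (hm : 0 < m) (hq : q = p ^ m) [CharP K p]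
    {F : Type*} [Field F] [Fintype F] (hF : Fintype.card F = q) (i : F →+* K)
    {lam lam' : K} (hl : lam ≠ 0) (hl' : lam' ≠ 0) {X Y x y : E} (h : AsmPair q lam X Y)
    (h' : AsmPair q lam' x y) (σ : F → (E →ₐ[K] E))
    (hσ : ∀ a, σ a X = X ∧ σ a Y = Y + algebraMap K E (i a)) :
    ∃ c : E, c ≠ 0 ∧ ∀ k l : ℕ, k + 2 ≤ q → l + 2 ≤ q → ∑ b, σ b (x ^ k * y ^ l * c) = 0 := by
  have hq1 : 1 < q := by rw [hq]; exact Nat.one_lt_pow hm.ne' hp.one_lt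
  have : CharP (AlgebraicClosure K) p :=
    charP_of_injective_algebraMap (algebraMap K _).injective p
  let L := AlgebraicClosure K
  let M := FractionRing (PowerSeries L)
  have : CharP M p := charP_of_injective_algebraMap (algebraMap L M).injective p
  obtain ⟨P⟩ := asm_exists_place L M p m q hp hm hq
  have hq0 : (q : M) = 0 := by
    rw [hq, Nat.cast_pow, CharP.cast_eq_zero, zero_pow hm.ne']
  obtain ⟨d, hd⟩ := P.exists_der hq0 hl h x
  obtain ⟨d', hd'⟩ := P.exists_der hq0 hl' h' X
  have hd0 : d ≠ 0 := by
    rintro rfl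
    obtain ⟨y0, hy0, -⟩ := P.exists_inf hq1 (algebraMap K L lam) 0 (by rw [zero_pow]; omega)
    rw [← IsScalarTower.algebraMap_apply] at hy0
    have htt : Transcendental K P.t⁻¹ := by
      apply AsmPlace.trans_of_trans (L := L)
      intro halg
      have := halg.inv
      rw [inv_inv] at this
      exact P.transcendental_of_lt P.t_ne P.t_lt this
    obtain ⟨φ, h1, h2⟩ := h.lift M _ _ hy0 htt
    have h3 := hd' φ
    rw [hd φ, map_zero, zero_mul, mul_zero, h1, P.δ_inv_t, neg_eq_zero] at h3
    exact pow_ne_zero 2 (inv_ne_zero P.t_ne) h3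
  refine ⟨d / (x ^ q - x), div_ne_zero hd0 (h'.u_ne hl'), ?_⟩
  intro k l hk hl2
  apply P.trace_zero hq1 hp hq hq0 hl h hF i σ hσ
  intro φ
  have h1 := P.holo hq0 hq1 (lam := algebraMap K L lam') (by simpa using hl')
    (AsmPlace.rel_map (L := L) h' φ) hk hl2
  have h2 : φ (x ^ k * y ^ l * (d / (x ^ q - x))) * P.δ (φ X) =
      φ x ^ k * φ y ^ l * (P.δ (φ x) / (φ x ^ q - φ x)) := by
    rw [hd φ]
    simp only [map_mul, map_pow, map_div₀, map_sub]
    ring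
  rw [h2]
  exact h1

theorem asm_poly_forms {F : Type*} [Fintype F] (σ : F → (E →ₐ[K] E)) {x y c : E} {n : ℕ}
    (h : ∀ k l : ℕ, k < n → l < n → ∑ b, σ b (x ^ k * y ^ l * c) = 0) (A B : Polynomial E)
    (hA : A.natDegree < n) (hB : B.natDegree < n) :
    ∑ b, A.eval (σ b x) * B.eval (σ b y) * σ b c = 0 := by
  simp_rw [Polynomial.eval_eq_sum_range' hA, Polynomial.eval_eq_sum_range' hB, Finset.sum_mul_sum,
    Finset.sum_mul]
  rw [Finset.sum_comm]
  apply Finset.sum_eq_zero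
  intro k hk
  rw [Finset.sum_comm]
  apply Finset.sum_eq_zero
  intro l hl
  have h1 := h k l (Finset.mem_range.1 hk) (Finset.mem_range.1 hl)
  have h2 : ∀ b, A.coeff k * σ b x ^ k * (B.coeff l * σ b y ^ l) * σ b c =
      (A.coeff k * B.coeff l) * σ b (x ^ k * y ^ l * c) := by
    intro b
    simp only [map_mul, map_pow]
    ring
  simp_rw [h2]
  rw [← Finset.mul_sum, h1, mul_zero]

theorem asm_split {F : Type*} [Field F] [Fintype F] [DecidableEq F] {q : ℕ} (hq2 : 2 < q)
    (hF : Fintype.card F = q) (Sx Sy : Finset F) (h0 : (0 : F) ∉ Sx) (h0' : (0 : F) ∉ Sy) (hx : Sx.Nonempty)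
    (hy : Sy.Nonempty) (hxy : ∀ a : F, a ≠ 0 → a ∈ Sx ∨ a ∈ Sy) :
    ∃ S1 S2 : Finset F, S1 ⊆ Sx ∧ S2 ⊆ Sy ∧ S1.card < q - 1 ∧ S2.card < q - 1 ∧
      ∀ a : F, a ≠ 0 → a ∈ S1 ∨ a ∈ S2 := by
  have hsub : Sx ⊆ Finset.univ.erase 0 := by
    intro a ha
    rw [Finset.mem_erase]
    refine ⟨?_, Finset.mem_univ _⟩
    rintro rfl
    exact h0 ha
  have hcard : (Finset.univ.erase (0 : F)).card = q - 1 := by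
    rw [Finset.card_erase_of_mem (Finset.mem_univ _), Finset.card_univ, hF]
  by_cases hc : Sx.card < q - 1
  · refine ⟨Sx, (Finset.univ.erase 0) \ Sx, subset_rfl, ?_, hc, ?_, ?_⟩
    · intro a ha
      rw [Finset.mem_sdiff, Finset.mem_erase] at ha
      exact (hxy a ha.1.1).resolve_left ha.2
    · rw [Finset.card_sdiff_of_subset hsub, hcard]
      have := hx.card_pos
      omega
    · intro a ha
      by_cases hax : a ∈ Sx
      · exact Or.inl hax
      · right
        rw [Finset.mem_sdiff, Finset.mem_erase]
        exact ⟨⟨ha, Finset.mem_univ _⟩, hax⟩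
  · have heq : Sx = Finset.univ.erase 0 :=
      Finset.eq_of_subset_of_card_le hsub (by omega)
    obtain ⟨a2, ha2⟩ := hy
    have h2 : a2 ∈ Sx := by
      rw [heq, Finset.mem_erase]
      refine ⟨?_, Finset.mem_univ _⟩
      rintro rfl
      exact h0' ha2
    refine ⟨Sx.erase a2, {a2}, Finset.erase_subset _ _, by simpa using ha2, ?_, ?_, ?_⟩
    · rw [Finset.card_erase_of_mem h2, heq, hcard]
      omega
    · rw [Finset.card_singleton]; omega
    · intro a ha
      by_cases haa : a = a2
      · right; simpa using haa
      · left
        rw [Finset.mem_erase, heq, Finset.mem_erase]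
        exact ⟨haa, ha, Finset.mem_univ _⟩

/-- The key dichotomy. -/
theorem asm_core {p m : ℕ} (hp : p.Prime) (hm : 0 < m) (hq : q = p ^ m) (hq2 : 2 < q) [CharP K p]
    {F : Type*} [Field F] [Fintype F] (hF : Fintype.card F = q) (i : F →+* K)
    {lam lam' : K} (hl : lam ≠ 0) (hl' : lam' ≠ 0) {X Y x y : E} (h : AsmPair q lam X Y)
    (h' : AsmPair q lam' x y) : x ∈ K⟮X⟯ ∨ y ∈ K⟮X⟯ := by
  classical
  have hq1 : 1 < q := by omega
  obtain ⟨σ, hσ⟩ := h.autos hp hq hF i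
  by_contra hcon
  rw [not_or] at hcon
  have hx : ∃ a, σ a x ≠ x := by
    by_contra hall
    push Not at hall
    exact hcon.1 (h.mem_of_fixed hq1 hF i hl σ hσ hall)
  have hy : ∃ a, σ a y ≠ y := by
    by_contra hall
    push Not at hall
    exact hcon.2 (h.mem_of_fixed hq1 hF i hl σ hσ hall)
  have hσ0 : ∀ z, σ 0 z = z := by
    intro z
    have := h.hom_ext (φ := σ 0) (ψ := AlgHom.id K E) (by simp [(hσ 0).1]) (by simp [(hσ 0).2]) z
    simpa using this
  let Sx : Finset F := Finset.univ.filter (fun a => σ a x ≠ x)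
  let Sy : Finset F := Finset.univ.filter (fun a => σ a y ≠ y)
  have hSx : ∀ a, a ∈ Sx ↔ σ a x ≠ x := by intro a; simp [Sx]
  have hSy : ∀ a, a ∈ Sy ↔ σ a y ≠ y := by intro a; simp [Sy]
  obtain ⟨S1, S2, h1, h2, hc1, hc2, hcov⟩ := asm_split hq2 hF Sx Sy
    (by rw [hSx]; simp [hσ0]) (by rw [hSy]; simp [hσ0])
    (by obtain ⟨a, ha⟩ := hx; exact ⟨a, (hSx a).2 ha⟩)
    (by obtain ⟨a, ha⟩ := hy; exact ⟨a, (hSy a).2 ha⟩)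
    (by
      intro a ha
      rw [hSx, hSy]
      by_contra hcon2
      rw [not_or, not_not, not_not] at hcon2
      have h3 := h'.hom_ext (φ := σ a) (ψ := AlgHom.id K E) (by simp [hcon2.1])
        (by simp [hcon2.2]) Y
      rw [(hσ a).2] at h3
      simp at h3
      exact ha h3)
  obtain ⟨c, hc0, hc⟩ := asm_exists_forms hp hm hq hF i hl hl' h h' σ hσ
  have h4 := asm_poly_forms σ (n := q - 1) (fun k l hk hl => hc k l (by omega) (by omega))
    (∏ a ∈ S1, (Polynomial.X - Polynomial.C (σ a x)))
    (∏ a ∈ S2, (Polynomial.X - Polynomial.C (σ a y)))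
    (by rw [Polynomial.natDegree_finsetProd_X_sub_C_eq_card]; exact hc1)
    (by rw [Polynomial.natDegree_finsetProd_X_sub_C_eq_card]; exact hc2)
  rw [Finset.sum_eq_single 0] at h4
  · rw [hσ0, hσ0, hσ0, Polynomial.eval_prod, Polynomial.eval_prod] at h4
    rcases mul_eq_zero.1 h4 with h5 | h5
    · rcases mul_eq_zero.1 h5 with h6 | h6
      · obtain ⟨a, ha, h7⟩ := Finset.prod_eq_zero_iff.1 h6
        simp only [Polynomial.eval_sub, Polynomial.eval_X, Polynomial.eval_C, sub_eq_zero] at h7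
        exact (hSx a).1 (h1 ha) h7.symm
      · obtain ⟨a, ha, h7⟩ := Finset.prod_eq_zero_iff.1 h6
        simp only [Polynomial.eval_sub, Polynomial.eval_X, Polynomial.eval_C, sub_eq_zero] at h7
        exact (hSy a).1 (h2 ha) h7.symm
    · exact hc0 h5
  · intro b _ hb
    rcases hcov b hb with h5 | h5
    · rw [Polynomial.eval_prod, Finset.prod_eq_zero h5 (by simp)]
      simp
    · rw [Polynomial.eval_prod, Polynomial.eval_prod, Finset.prod_eq_zero (i := b) h5 (by simp)]
      simp
  · intro h5
    exact absurd (Finset.mem_univ _) h5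

end AsmCore


section AsmEnd
open IntermediateField

theorem asm_quad {K E : Type*} [Field K] [Field E] [Algebra K E] {z : E} (hz : Transcendental K z)
    {a b c : K} (h : algebraMap K E a * z ^ 2 + algebraMap K E b * z + algebraMap K E c = 0) :
    a = 0 ∧ b = 0 ∧ c = 0 := by
  have h1 := transcendental_iff.1 hz (Polynomial.C a * Polynomial.X ^ 2 +
    Polynomial.C b * Polynomial.X + Polynomial.C c) (by simpa using h)
  refine ⟨?_, ?_, ?_⟩
  · have := congrArg (fun g => Polynomial.coeff g 2) h1
    simpa [Polynomial.coeff_X, Polynomial.coeff_C] using this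
  · have := congrArg (fun g => Polynomial.coeff g 1) h1
    simpa [Polynomial.coeff_X, Polynomial.coeff_C, Polynomial.coeff_X_pow] using this
  · have := congrArg (fun g => Polynomial.coeff g 0) h1
    simpa [Polynomial.coeff_X, Polynomial.coeff_C, Polynomial.coeff_X_pow] using this

theorem asm_trans_as {K E : Type*} [Field K] [Field E] [Algebra K E] {q : ℕ} (hq : 1 < q)
    {x : E} (hx : Transcendental K x) : Transcendental K (x ^ q - x) := by
  intro hc
  apply hx
  have hdeg : (Polynomial.X ^ q - Polynomial.X : Polynomial K).natDegree = q :=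
    FiniteField.X_pow_card_sub_X_natDegree_eq K hq
  have hmon : (Polynomial.X ^ q - Polynomial.X : Polynomial K).Monic :=
    Polynomial.monic_X_pow_sub (by rw [Polynomial.degree_X]; exact_mod_cast hq)
  exact (IsIntegral.of_aeval_monic hmon (by rw [hdeg]; omega)
    (by simpa using hc.isIntegral)).isAlgebraic

theorem asm_mem_image {K E : Type*} [Field K] [Field E] [Algebra K E] {q : ℕ} (hq : 1 < q)
    {F : Type*} [Field F] [Fintype F] (hF : Fintype.card F = q) (i : F →+* K) {z : E}
    (hz : z ^ q = z) : ∃ b : F, z = algebraMap K E (i b) := by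
  by_contra hcon
  push Not at hcon
  have hdeg : (Polynomial.X ^ q - Polynomial.X : Polynomial E).natDegree = q :=
    FiniteField.X_pow_card_sub_X_natDegree_eq E hq
  have h0 : (Polynomial.X ^ q - Polynomial.X : Polynomial E) = 0 := by
    apply Polynomial.eq_zero_of_natDegree_lt_card_of_eval_eq_zero (ι := Option F)
      (f := fun o => o.elim z (fun b => algebraMap K E (i b)))
    · intro a b hab
      cases a with
      | none =>
        cases b with
        | none => rfl
        | some b => exact absurd hab (hcon b)
      | some a =>
        cases b with
        | none => exact absurd hab.symm (hcon a)
        | some b =>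
          congr 1
          exact i.injective ((algebraMap K E).injective hab)
    · intro o
      cases o with
      | none => simp [hz]
      | some b =>
        have hb : b ^ q = b := by rw [← hF]; exact FiniteField.pow_card b
        have : (algebraMap K E (i b)) ^ q = algebraMap K E (i b) := by
          rw [← map_pow, ← map_pow, hb]
        simp [this]
    · rw [hdeg, Fintype.card_option, hF]
      omega
  rw [h0] at hdeg
  simp at hdeg
  omega

theorem asm_mobius {K E : Type*} [Field K] [Field E] [Algebra K E] {X x : E}
    (hX : Transcendental K X) (hx : x ∈ K⟮X⟯) (hXx : X ∈ K⟮x⟯) :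
    ∃ a b c d : K, (algebraMap K E c * X + algebraMap K E d ≠ 0) ∧
      x * (algebraMap K E c * X + algebraMap K E d) = algebraMap K E a * X + algebraMap K E b := by
  let e := RatFunc.algEquivOfTranscendental X hX
  let f : RatFunc K := e.symm ⟨x, hx⟩
  have hef : e f = ⟨x, hx⟩ := e.apply_symm_apply _
  have hmem : (RatFunc.X : RatFunc K) ∈ K⟮f⟯ := by
    rw [mem_adjoin_simple_iff] at hXx ⊢
    obtain ⟨r, s, hrs⟩ := hXx
    refine ⟨r, s, ?_⟩
    apply e.injective
    rw [map_div₀, ← Polynomial.aeval_algHom_apply, ← Polynomial.aeval_algHom_apply, hef]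
    apply Subtype.ext
    have h1 : ((e RatFunc.X : K⟮X⟯) : E) = X := RatFunc.algEquivOfTranscendental_X X hX
    rw [h1]
    have h2 : ∀ g : Polynomial K, ((Polynomial.aeval (⟨x, hx⟩ : K⟮X⟯) g : K⟮X⟯) : E) =
        Polynomial.aeval x g := by
      intro g
      exact (Polynomial.aeval_algHom_apply (K⟮X⟯.val) (⟨x, hx⟩ : K⟮X⟯) g).symm
    refine hrs.trans ?_
    push_cast
    rw [h2, h2]
  have htop : K⟮f⟯ = ⊤ := by
    rw [eq_top_iff, ← RatFunc.adjoin_X, adjoin_simple_le_iff]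
    exact hmem
  have hfin := RatFunc.finrank_eq_max_natDegree f
  rw [htop, IntermediateField.finrank_top] at hfin
  have hn : f.num.natDegree ≤ 1 := by rw [hfin]; exact le_max_left _ _
  have hd : f.denom.natDegree ≤ 1 := by rw [hfin]; exact le_max_right _ _
  have hxf : x = Polynomial.aeval X f.num / Polynomial.aeval X f.denom := by
    have := RatFunc.algEquivOfTranscendental_apply X hX f
    have h3 : ((e f : K⟮X⟯) : E) = x := by rw [hef]
    rw [← h3]
    exact this
  have hd0 : Polynomial.aeval X f.denom ≠ 0 := fun h1 =>
    f.denom_ne_zero (transcendental_iff.1 hX _ h1)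
  rw [eq_div_iff hd0] at hxf
  have hn' := congrArg (Polynomial.aeval X) (Polynomial.eq_X_add_C_of_natDegree_le_one hn)
  have hd' := congrArg (Polynomial.aeval X) (Polynomial.eq_X_add_C_of_natDegree_le_one hd)
  simp only [map_add, map_mul, Polynomial.aeval_C, Polynomial.aeval_X] at hn' hd'
  refine ⟨f.num.coeff 1, f.num.coeff 0, f.denom.coeff 1, f.denom.coeff 0, ?_, ?_⟩
  · rw [← hd']; exact hd0
  · rw [← hd', ← hn']; exact hxf

variable {q : ℕ} {K E : Type u} [Field K] [Field E] [Algebra K E]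

theorem AsmPair.notMem {p m : ℕ} (hp : p.Prime) (hq : q = p ^ m) [CharP K p]
    {F : Type*} [Field F] [Fintype F] (hF : Fintype.card F = q) (i : F →+* K)
    {lam : K} {X Y : E} (h : AsmPair q lam X Y) : Y ∉ K⟮X⟯ := by
  intro hY
  obtain ⟨σ, hσ⟩ := h.autos hp hq hF i
  have h1 := asm_fix (σ 1) (hσ 1).1 hY
  rw [(hσ 1).2] at h1
  simp at h1

theorem asm_affine {p m : ℕ} (hp : p.Prime) (hq : q = p ^ m) (hq2 : 2 < q) [CharP K p]
    {F : Type*} [Field F] [Fintype F] (hF : Fintype.card F = q) (i : F →+* K)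
    {lam lam' : K} (hl : lam ≠ 0) (hl' : lam' ≠ 0) {X Y x y : E} (h : AsmPair q lam X Y)
    (h' : AsmPair q lam' x y) (hx : x ∈ K⟮X⟯) (hX : X ∈ K⟮x⟯) (hy : y ∈ K⟮Y⟯) :
    ∃ (b : F) (e : K), b ≠ 0 ∧ x = algebraMap K E (i b) * X + algebraMap K E e := by
  have hq1 : 1 < q := by omega
  have : Fact p.Prime := ⟨hp⟩
  have : CharP E p := charP_of_injective_algebraMap (algebraMap K E).injective p
  obtain ⟨σ, hσ⟩ := (h.symm hq1 hl).autos hp hq hF i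
  obtain ⟨hσY, hσX⟩ := hσ 1
  set s := σ 1 with hs
  rw [map_one, map_one] at hσX
  have hsy : s y = y := asm_fix s hσY hy
  have hsu : s x ^ q - s x = x ^ q - x := by
    have h1 := congrArg s h'.rel
    rw [map_mul, AlgHom.commutes, ← h'.rel, map_sub, map_sub, map_pow, map_pow, hsy] at h1
    exact mul_right_cancel₀ (h'.v_ne hl') h1
  obtain ⟨b, hb⟩ := asm_mem_image (K := K) hq1 hF i (z := s x - x) (by
    have : (s x - x) ^ q = s x ^ q - x ^ q := by
      rw [hq, sub_pow_char_pow]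
    rw [this]
    linear_combination hsu)
  have hsx : s x = x + algebraMap K E (i b) := by rw [← hb]; ring
  have hb0 : b ≠ 0 := by
    rintro rfl
    rw [map_zero, map_zero, add_zero] at hsx
    have := asm_fix s hsx hX
    rw [hσX] at this
    simp at this
  obtain ⟨a0, b0, c, d, hne, hm⟩ := asm_mobius h.trX hx hX
  have hm2 := congrArg s hm
  simp only [map_mul, map_add, AlgHom.commutes, hσX, hsx] at hm2
  have hc : c = 0 := by
    have h3 : algebraMap K E (i b * c ^ 2) * X ^ 2 +
        algebraMap K E (i b * c * (c + 2 * d)) * X +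
        algebraMap K E (c * b0 + i b * d * (c + d) - a0 * d) = 0 := by
      simp only [map_mul, map_add, map_sub, map_pow, map_ofNat]
      linear_combination (algebraMap K E c * X + algebraMap K E d) * hm2 -
        (algebraMap K E c * (X + 1) + algebraMap K E d) * hm
    have h4 := (asm_quad h.trX h3).1
    have hib : i b ≠ 0 := by simpa using hb0
    simpa [hib] using h4
  subst hc
  simp only [map_zero, zero_mul, zero_add] at hm hm2 hne
  have hab : a0 = i b * d := by
    apply (algebraMap K E).injective
    rw [map_mul]
    linear_combination hm - hm2
  refine ⟨b, b0 / d, hb0, ?_⟩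
  rw [map_div₀]
  field_simp
  rw [hab, map_mul] at hm
  linear_combination hm

theorem asm_end {p m : ℕ} (hp : p.Prime) (hm : 0 < m) (hq : q = p ^ m) (hq2 : 2 < q) [CharP K p]
    {F : Type*} [Field F] [Fintype F] (hF : Fintype.card F = q) (i : F →+* K)
    {lam lam' : K} (hl : lam ≠ 0) (hl' : lam' ≠ 0) {X Y x y : E} (h : AsmPair q lam X Y)
    (h' : AsmPair q lam' x y) (hx : x ∈ K⟮X⟯) : ∃ ζ : F, ζ ≠ 0 ∧ lam = i ζ * lam' := by
  have hq1 : 1 < q := by omega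
  have : Fact p.Prime := ⟨hp⟩
  have : CharP E p := charP_of_injective_algebraMap (algebraMap K E).injective p
  have hs := h.symm hq1 hl
  have hs' := h'.symm hq1 hl'
  have hX : X ∈ K⟮x⟯ := by
    rcases asm_core hp hm hq hq2 hF i hl' hl h' h with h1 | h1
    · exact h1
    · exact absurd (adjoin_simple_le_iff.2 hx h1) (h.notMem hp hq hF i)
  have hy : y ∈ K⟮Y⟯ := by
    rcases asm_core hp hm hq hq2 hF i hl hl' hs h' with h1 | h1
    · exact absurd (adjoin_simple_le_iff.2 h1 hX) (hs.notMem hp hq hF i)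
    · exact h1
  have hY : Y ∈ K⟮y⟯ := by
    rcases asm_core hp hm hq hq2 hF i hl' hl hs' h with h1 | h1
    · exact absurd (adjoin_simple_le_iff.2 hy h1) (hs.notMem hp hq hF i)
    · exact h1
  obtain ⟨b, e, hb, hxe⟩ := asm_affine hp hq hq2 hF i hl hl' h h' hx hX hy
  obtain ⟨b', e', hb', hye⟩ := asm_affine hp hq hq2 hF i hl hl' hs hs' hy hY hx
  have hpow : ∀ b : F, (algebraMap K E (i b)) ^ q = algebraMap K E (i b) := by
    intro b
    have hb : b ^ q = b := by rw [← hF]; exact FiniteField.pow_card b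
    rw [← map_pow, ← map_pow, hb]
  have key : ∀ (b : F) (e : K) (Z : E), (algebraMap K E (i b) * Z + algebraMap K E e) ^ q -
      (algebraMap K E (i b) * Z + algebraMap K E e) =
      algebraMap K E (i b) * (Z ^ q - Z) + algebraMap K E (e ^ q - e) := by
    intro b e Z
    have h1 : (algebraMap K E (i b) * Z + algebraMap K E e) ^ q =
        algebraMap K E (i b) * Z ^ q + algebraMap K E e ^ q := by
      rw [← hpow b, hq, add_pow_char_pow, mul_pow, ← hq, hpow b, hpow b]
    rw [h1, map_sub, map_pow]
    ring
  have hrel' := h'.rel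
  rw [hxe, hye, key, key] at hrel'
  have hrel := h.rel
  have htr := asm_trans_as hq1 h.trX
  set U := X ^ q - X with hU
  set V := Y ^ q - Y with hV
  have h3 : algebraMap K E (i b * (e' ^ q - e')) * U ^ 2 +
      algebraMap K E (i b * i b' * lam + (e ^ q - e) * (e' ^ q - e') - lam') * U +
      algebraMap K E (i b' * (e ^ q - e) * lam) = 0 := by
    simp only [map_sub (algebraMap K E), map_add, map_mul] at hrel' ⊢
    linear_combination U * hrel' - (algebraMap K E (i b) * algebraMap K E (i b') * U +
      algebraMap K E (i b') * (algebraMap K E (e ^ q) - algebraMap K E e)) * hrel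
  obtain ⟨h4, h5, h6⟩ := asm_quad htr h3
  have hib : i b ≠ 0 := by simpa using hb
  have hib' : i b' ≠ 0 := by simpa using hb'
  have h7 : e' ^ q - e' = 0 := (mul_eq_zero.1 h4).resolve_left hib
  rw [h7, mul_zero, add_zero, sub_eq_zero] at h5
  refine ⟨(b * b')⁻¹, inv_ne_zero (mul_ne_zero hb hb'), ?_⟩
  rw [← h5, map_inv₀, map_mul]
  field_simp

end AsmEnd


theorem asm_converse {p m q : ℕ} (hp : p.Prime) (hm : 0 < m) (hq : q = p ^ m)
    {K : Type u} [Field K] {E E' : Type u} [Field E] [Algebra K E] [Field E'] [Algebra K E']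
    {F : Type*} [Field F] [Fintype F] (hF : Fintype.card F = q) (i : F →+* K)
    {lam lam' : K} {X Y : E} {x y : E'} (h : AsmPair q lam X Y) (h' : AsmPair q lam' x y)
    (ζ : F) (hζ : ζ ≠ 0) (hl : lam = i ζ * lam') : Nonempty (E ≃ₐ[K] E') := by
  have hz : ζ ^ q = ζ := by rw [← hF]; exact FiniteField.pow_card ζ
  have hz' : (algebraMap K E' (i ζ)) ^ q = algebraMap K E' (i ζ) := by
    rw [← map_pow, ← map_pow, hz]
  have hz0 : algebraMap K E' (i ζ) ≠ 0 := by simpa using hζ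
  have hback : x = algebraMap K E' (i ζ)⁻¹ * (algebraMap K E' (i ζ) * x) := by
    rw [map_inv₀, inv_mul_cancel_left₀ hz0]
  obtain ⟨φ, hφX, hφY⟩ := h.lift E' (algebraMap K E' (i ζ) * x) y (by
      rw [mul_pow, hz', hl, map_mul, ← h'.rel]; ring) (by
      intro hal
      apply h'.trX
      rw [hback]
      exact (isAlgebraic_algebraMap _).mul hal)
  refine ⟨AlgEquiv.ofBijective φ ⟨φ.toRingHom.injective, ?_⟩⟩
  have htop : φ.fieldRange = ⊤ := by
    rw [eq_top_iff, ← h'.gen, IntermediateField.adjoin_le_iff]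
    rintro z (rfl | hz1)
    · rw [hback, ← hφX]
      exact mul_mem (IntermediateField.algebraMap_mem _ _) ⟨X, rfl⟩
    · rw [Set.mem_singleton_iff] at hz1
      rw [hz1, ← hφY]
      exact ⟨Y, rfl⟩
  intro z
  have : z ∈ φ.fieldRange := by rw [htop]; trivial
  exact this


/-- Two Artin–Schreier–Mumford curves `X_{λ₁}` and `X_{λ₂}` are isomorphic (their function
fields `F_{λᵢ} = Frac K[X,Y]/((X^q−X)(Y^q−Y) − λᵢ)` are `K`-isomorphic) if and only if
`λ₁ = ζ λ₂` for some nonzero `ζ ∈ F_q`. -/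
theorem asm_curves_isomorphic_iff
    {p m : ℕ} (hp : p.Prime) (hm : 0 < m) {q : ℕ} (hq : q = p ^ m) (hq2 : 2 < q)
    {K : Type*} [Field K] [CharP K p]
    {F : Type*} [Field F] [Fintype F] (hF : Fintype.card F = q) (i : F →+* K)
    (lam₁ lam₂ : K) (h₁ : lam₁ ≠ 0) (h₂ : lam₂ ≠ 0)
    [IsDomain (asmRing K q lam₁)] [IsDomain (asmRing K q lam₂)] :
    (∃ e : FractionRing (asmRing K q lam₁) ≃+* FractionRing (asmRing K q lam₂),
        ∀ c : K,
          e (algebraMap (asmRing K q lam₁) (FractionRing (asmRing K q lam₁))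
              (algebraMap K (asmRing K q lam₁) c)) =
            algebraMap (asmRing K q lam₂) (FractionRing (asmRing K q lam₂))
              (algebraMap K (asmRing K q lam₂) c))
      ↔ ∃ ζ : F, ζ ≠ 0 ∧ lam₁ = i ζ * lam₂ := by
  have hq1 : 1 < q := by omega
  constructor
  · rintro ⟨e, he⟩
    let e' : FractionRing (asmRing K q lam₁) ≃ₐ[K] FractionRing (asmRing K q lam₂) :=
      AlgEquiv.ofRingEquiv (f := e) (by
        intro c
        rw [IsScalarTower.algebraMap_apply K (asmRing K q lam₁) (FractionRing (asmRing K q lam₁)),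
          IsScalarTower.algebraMap_apply K (asmRing K q lam₂) (FractionRing (asmRing K q lam₂))]
        exact he c)
    have h := (asm_base hp hm hq lam₁ h₁).map e'
    have h' := asm_base hp hm hq lam₂ h₂
    rcases asm_core hp hm hq hq2 hF i h₁ h₂ h h' with hx | hy
    · exact asm_end hp hm hq hq2 hF i h₁ h₂ h h' hx
    · exact asm_end hp hm hq hq2 hF i h₁ h₂ h (h'.symm hq1 h₂) hy
  · rintro ⟨ζ, hζ, hl⟩
    obtain ⟨e⟩ := asm_converse hp hm hq hF i (asm_base hp hm hq lam₁ h₁)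
      (asm_base hp hm hq lam₂ h₂) ζ hζ hl
    refine ⟨e.toRingEquiv, ?_⟩
    intro c
    rw [← IsScalarTower.algebraMap_apply K (asmRing K q lam₁) (FractionRing (asmRing K q lam₁)),
      ← IsScalarTower.algebraMap_apply K (asmRing K q lam₂) (FractionRing (asmRing K q lam₂))]
    exact e.commutes c
end

section
/- Let p be a prime, q = p^m, and let K be a field of characteristic p containing F_q, equipped with a nonarchimedean multiplicative norm |·|. Let t ∈ K with 0 < |t| < 1. For u, v ∈ F_q^*, define the 2×2 matrices over K: E_u = [[1,u],[0,1]] and A_{v} = [[1,0],[v/t,1]], and set D_{u,v} = E_u · A_v · E_{−u} · A_{−v} (a determinant-1 representative of the Schottky generator δ_{u,v}). Then for every r ≥ 1 and every choice of pairs (u₁,v₁), …, (u_r,v_r) ∈ F_q^* × F_q^*, the (2,1)-entry of the matrix product W = D_{u₁,v₁} · D_{u₂,v₂} ⋯ D_{u_r,v_r} has norm |W_{2,1}| = |t|^{−2r}. -/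
theorem asm_aux_add {K : Type*} [NormedField K] [IsUltrametricDist K] (x y : K)
    (h : ‖y‖ < ‖x‖) : ‖x + y‖ = ‖x‖ := by
  rw [IsUltrametricDist.norm_add_eq_max_of_norm_ne_norm h.ne', max_eq_left h.le]

theorem asm_aux_le {K : Type*} [NormedField K] [IsUltrametricDist K] {x y : K} {N : ℝ}
    (hx : ‖x‖ ≤ N) (hy : ‖y‖ ≤ N) : ‖x + y‖ ≤ N :=
  (IsUltrametricDist.norm_add_le_max x y).trans (max_le hx hy)

/-- One step: action of `D_{u,v}` on a column `(a, c)` with `‖c‖ ≤ ‖a‖`. -/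
theorem asm_aux_step {K : Type*} [NormedField K] [IsUltrametricDist K] (t u v a c : K)
    (ht0 : 0 < ‖t‖) (ht1 : ‖t‖ < 1) (hu : ‖u‖ = 1) (hv : ‖v‖ = 1)
    (ha : 0 < ‖a‖) (hc : ‖c‖ ≤ ‖a‖) :
    ‖t ^ 2 * ((1 + u * v / t + (u * v / t) ^ 2) * a + (-(u * (u * v / t))) * c)‖ = ‖a‖ ∧
    ‖t ^ 2 * ((v / t * (u * v / t)) * a + (1 - u * v / t) * c)‖ = ‖a‖ := by
  have ht : t ≠ 0 := norm_pos_iff.mp ht0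
  have key : ∀ x y : K, ‖x‖ = ‖a‖ → ‖y‖ ≤ ‖a‖ → ‖x + t * y‖ = ‖a‖ := by
    intro x y hx hy
    rw [asm_aux_add, hx]
    rw [hx, norm_mul]
    nlinarith [norm_nonneg y]
  have htw : ‖t + u * v‖ ≤ 1 := asm_aux_le ht1.le (by simp [hu, hv])
  have htw' : ‖t + -(u * v)‖ ≤ 1 := asm_aux_le ht1.le (by simp [hu, hv])
  constructor
  · rw [show t ^ 2 * ((1 + u * v / t + (u * v / t) ^ 2) * a + (-(u * (u * v / t))) * c)
      = (u * v) ^ 2 * a + t * ((t + u * v) * a + (-(u * (u * v)) * c)) by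
        field_simp; ring]
    apply key
    · simp [hu, hv]
    · apply asm_aux_le
      · rw [norm_mul]; exact mul_le_of_le_one_left ha.le htw
      · simpa [hu, hv] using hc
  · rw [show t ^ 2 * ((v / t * (u * v / t)) * a + (1 - u * v / t) * c)
      = v * (u * v) * a + t * ((t + -(u * v)) * c) by field_simp; ring]
    apply key
    · simp [hu, hv]
    · rw [norm_mul]
      exact (mul_le_of_le_one_left (norm_nonneg c) htw').trans hc

theorem asm_aux_word {K : Type*} [NormedField K] [IsUltrametricDist K] (t : K)
    (ht0 : 0 < ‖t‖) (ht1 : ‖t‖ < 1) (r : ℕ) (u v : Fin r → K)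
    (hu : ∀ j, ‖u j‖ = 1) (hv : ∀ j, ‖v j‖ = 1)
    (P : Matrix (Fin 2) (Fin 2) K)
    (hP : P = (List.ofFn fun j : Fin r =>
        (!![1, u j; 0, 1] : Matrix (Fin 2) (Fin 2) K) *
          !![1, 0; v j / t, 1] * !![1, -u j; 0, 1] *
          !![1, 0; -v j / t, 1]).prod) :
    ‖P 0 0‖ = (‖t‖ ^ (2 * r))⁻¹ ∧ ‖P 1 0‖ ≤ ‖P 0 0‖ ∧ (1 ≤ r → ‖P 1 0‖ = ‖P 0 0‖) := by
  induction r generalizing P with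
  | zero => subst hP; simp
  | succ n ih =>
    rw [List.ofFn_succ, List.prod_cons] at hP
    obtain ⟨h1, h2, -⟩ := ih (fun j => u j.succ) (fun j => v j.succ) (fun j => hu _)
      (fun j => hv _) _ rfl
    generalize (List.ofFn fun j : Fin n =>
        (!![1, u j.succ; 0, 1] : Matrix (Fin 2) (Fin 2) K) *
          !![1, 0; v j.succ / t, 1] * !![1, -u j.succ; 0, 1] *
          !![1, 0; -v j.succ / t, 1]).prod = Q at hP h1 h2
    have hQ : 0 < ‖Q 0 0‖ := by rw [h1]; positivity
    obtain ⟨e1, e2⟩ := asm_aux_step t (u 0) (v 0) (Q 0 0) (Q 1 0) ht0 ht1 (hu 0) (hv 0) hQ h2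
    have p1 : P 0 0 = (1 + u 0 * v 0 / t + (u 0 * v 0 / t) ^ 2) * Q 0 0
        + (-(u 0 * (u 0 * v 0 / t))) * Q 1 0 := by
      subst hP
      simp [Matrix.mul_apply, Fin.sum_univ_two]
      ring
    have p2 : P 1 0 = (v 0 / t * (u 0 * v 0 / t)) * Q 0 0
        + (1 - u 0 * v 0 / t) * Q 1 0 := by
      subst hP
      simp [Matrix.mul_apply, Fin.sum_univ_two]
      ring
    rw [← p1, norm_mul, norm_pow] at e1
    rw [← p2, norm_mul, norm_pow] at e2
    have h : ‖P 1 0‖ = ‖P 0 0‖ :=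
      mul_left_cancel₀ (pow_pos ht0 2).ne' (e2.trans e1.symm)
    refine ⟨?_, h.le, fun _ => h⟩
    apply mul_left_cancel₀ (pow_pos ht0 2).ne'
    rw [e1, h1]
    have := ht0.ne'
    field_simp
    ring

/-- The lower-left entry of a length-`r` word `D_{u₁,v₁} ⋯ D_{u_r,v_r}` in the
determinant-one representatives `D_{u,v} = E_u A_v E_{−u} A_{−v}`
(with `E_u = [[1,u],[0,1]]`, `A_v = [[1,0],[v/t,1]]`) of the free generators of the Schottky
group of the Artin–Schreier–Mumford curve has norm `|t|^{−2r}`. -/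
theorem asm_word_lower_left_entry_norm
    {p m : ℕ} (hp : p.Prime) (hm : 0 < m) {q : ℕ} (hq : q = p ^ m)
    {K : Type*} [NormedField K] [IsUltrametricDist K] [CharP K p]
    {F : Type*} [Field F] [Fintype F] (hF : Fintype.card F = q) (i : F →+* K)
    (t : K) (ht0 : 0 < ‖t‖) (ht1 : ‖t‖ < 1)
    (r : ℕ) (hr : 1 ≤ r) (u v : Fin r → F) (hu : ∀ j, u j ≠ 0) (hv : ∀ j, v j ≠ 0) :
    ‖(List.ofFn fun j : Fin r =>
        (!![1, i (u j); 0, 1] : Matrix (Fin 2) (Fin 2) K) *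
          !![1, 0; i (v j) / t, 1] * !![1, i (-u j); 0, 1] *
          !![1, 0; i (-v j) / t, 1]).prod 1 0‖ = (‖t‖ ^ (2 * r))⁻¹ := by
  have hn : ∀ x : F, x ≠ 0 → ‖i x‖ = 1 := by
    intro x hx
    have h := congrArg (fun y => ‖i y‖) (FiniteField.pow_card_sub_one_eq_one x hx)
    simp only [map_pow, norm_pow, map_one, norm_one] at h
    exact (pow_eq_one_iff_of_nonneg (norm_nonneg _)
      (Nat.sub_pos_of_lt Fintype.one_lt_card).ne').mp h
  simp only [map_neg]
  obtain ⟨h1, -, h3⟩ := asm_aux_word t ht0 ht1 r (fun j => i (u j)) (fun j => i (v j))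
    (fun j => hn _ (hu j)) (fun j => hn _ (hv j)) _ rfl
  rw [← h1]
  exact h3 hr
end
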